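/- arXiv:1201.5593 — 4 statements merged into one kernel-verified Lean document; each statement's English description precedes it below -/
import Mathlib

section
/- In Setup (§2): for every subset X ⊆ {0,2,4,…} ∩ [0,μ−1], the sequence a^X belongs to ℰ, and the multiset [a°^X] = {a°^X_0,…,a°^X_N} equals the multiset [a°] = {a°_0,…,a°_N}. -/
/-- Two maps on `{0,…,N}` that differ by an involution have the same multiset of values. -/
theorem map_range_eq_of_involution {α : Type*} (N : ℕ) (f g : ℕ → α) (σ : ℕ → ℕ)
    (hle : ∀ i ≤ N, σ i ≤ N) (hσ : ∀ i ≤ N, σ (σ i) = i) (h : ∀ i ≤ N, f i = g (σ i)) :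
    (Multiset.range (N + 1)).map f = (Multiset.range (N + 1)).map g := by
  have hmem : ∀ i, i ∈ Multiset.range (N + 1) ↔ i ≤ N := fun i => by
    rw [Multiset.mem_range]; omega
  refine Multiset.map_eq_map_of_bij_of_nodup f g (Multiset.nodup_range _)
    (Multiset.nodup_range _) (fun i _ => σ i) ?_ ?_ ?_ ?_
  · intro i hi
    exact (hmem _).2 (hle i ((hmem i).1 hi))
  · intro i hi j hj hij
    rw [← hσ i ((hmem i).1 hi), ← hσ j ((hmem j).1 hj)]
    exact congrArg σ hij
  · intro j hj
    have hj' := (hmem j).1 hj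
    exact ⟨σ j, (hmem _).2 (hle j hj'), hσ j hj'⟩
  · intro i hi
    exact h i ((hmem i).1 hi)

theorem le_of_le_succ_of_le {N : ℕ} {a : ℕ → ℕ} (hmono : ∀ i, i + 1 ≤ N → a i ≤ a (i + 1))
    {i j : ℕ} (hij : i ≤ j) (hj : j ≤ N) : a i ≤ a j := by
  induction j, hij using Nat.le_induction with
  | base => exact le_rfl
  | succ j _ ih => exact (ih (by omega)).trans (hmono j hj)

/-- A value of a weakly increasing sequence that differs from its neighbours occurs once. -/
theorem card_filter_eq_one_of_neighbours_lt {N : ℕ} {a : ℕ → ℕ}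
    (hmono : ∀ i, i + 1 ≤ N → a i ≤ a (i + 1)) {i : ℕ} (hi : i ≤ N)
    (hnext : i + 1 ≤ N → a i < a (i + 1)) (hprev : ∀ j, j + 1 = i → a j < a i) :
    ((Finset.range (N + 1)).filter fun j => a j = a i).card = 1 := by
  refine Finset.card_eq_one.2 ⟨i, ?_⟩
  ext j
  simp only [Finset.mem_filter, Finset.mem_range, Finset.mem_singleton]
  refine ⟨fun ⟨hj, hji⟩ => ?_, fun h => by subst h; exact ⟨by omega, rfl⟩⟩
  rcases lt_trichotomy j i with h | h | h
  · obtain ⟨p, rfl⟩ : ∃ p, i = p + 1 := ⟨i - 1, by omega⟩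
    have h1 := le_of_le_succ_of_le hmono (show j ≤ p by omega) (by omega)
    have h2 := hprev p rfl
    omega
  · exact h
  · have h1 := le_of_le_succ_of_le hmono (show i + 1 ≤ j by omega) (by omega)
    have h2 := hnext (by omega)
    omega

theorem eq_of_card_filter_eq_one {N : ℕ} {a : ℕ → ℕ} {i j : ℕ}
    (hcard : ((Finset.range (N + 1)).filter fun j => a j = a i).card = 1)
    (hi : i ≤ N) (hj : j ≤ N) (h : a j = a i) : j = i :=
  Finset.card_le_one.1 hcard.le j (by simp [h]; omega) i (by simp; omega)

/-- Before the first value of multiplicity one, the sequence consists of pairs of equal values;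
hence that value has an even index. -/
theorem even_of_first_singleton {N : ℕ} {a : ℕ → ℕ}
    (hmono : ∀ i, i + 1 ≤ N → a i ≤ a (i + 1)) (hstrict : ∀ i, i + 2 ≤ N → a i < a (i + 2))
    {p : ℕ} (hp : p ≤ N)
    (hcard : ((Finset.range (N + 1)).filter fun j => a j = a p).card = 1)
    (hfirst : ∀ i < p, ((Finset.range (N + 1)).filter fun j => a j = a i).card ≠ 1) :
    p % 2 = 0 := by
  have key : ∀ k, 2 * k < p → a (2 * k + 1) = a (2 * k) := by
    intro k
    induction k with
    | zero =>
      intro h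
      by_contra hne
      have := hmono (2 * 0) (by omega)
      exact hfirst _ h (card_filter_eq_one_of_neighbours_lt hmono (by omega)
        (fun _ => by omega) (fun j hj => by omega))
    | succ k ih =>
      intro h
      by_contra hne
      have h1 := ih (by omega)
      have h2 := hstrict (2 * k) (by omega)
      have h3 := hmono (2 * (k + 1)) (by omega)
      refine hfirst _ h (card_filter_eq_one_of_neighbours_lt hmono (by omega)
        (fun _ => by omega) (fun j hj => ?_))
      obtain rfl : j = 2 * k + 1 := by omega
      rw [show 2 * (k + 1) = 2 * k + 2 by ring]
      omega
  by_contra hodd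
  have h := key (p / 2) (by omega)
  rw [show 2 * (p / 2) + 1 = p by omega] at h
  have := eq_of_card_filter_eq_one hcard hp (show 2 * (p / 2) ≤ N by omega) h.symm
  omega

open Classical in
/-- Interchange `2k` and `2k + 1` whenever they satisfy `S`. -/
noncomputable def pairSwap (S : ℕ → Prop) (i : ℕ) : ℕ :=
  if S i then (if i % 2 = 0 then i + 1 else i - 1) else i

theorem pairSwap_div_two (S : ℕ → Prop) (i : ℕ) : pairSwap S i / 2 = i / 2 := by
  unfold pairSwap
  split_ifs <;> omega

theorem pairSwap_pairSwap {S : ℕ → Prop} (hS : ∀ e, e % 2 = 0 → (S e ↔ S (e + 1))) (i : ℕ) :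
    pairSwap S (pairSwap S i) = i := by
  unfold pairSwap
  by_cases hi : S i
  · rcases Nat.mod_two_eq_zero_or_one i with he | ho
    · have h1 := (hS i he).1 hi
      have h2 : (i + 1) % 2 ≠ 0 := by omega
      simp [hi, he, h1, h2]
    · obtain ⟨e, rfl⟩ : ∃ e, i = e + 1 := ⟨i - 1, by omega⟩
      have h1 := (hS e (by omega)).2 hi
      have h2 : e % 2 = 0 := by omega
      simp [hi, ho, h1, h2]
  · simp [hi]


/-- Setup §2: for every subset `X ⊆ {0,2,4,…} ∩ [0,μ-1]`, the
sequence `a^X` belongs to `ℰ`, and the multiset `[a°^X]` equals the multiset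
`[a°]`, where `b°_i = b_i + ⌊i/2⌋`. -/
theorem stmt_11 (N μ : ℕ) (a I m : ℕ → ℕ)
    (hμ : μ % 2 = N % 2)
    (hmono : ∀ i, i + 1 ≤ N → a i ≤ a (i + 1))
    (hstrict : ∀ i, i + 2 ≤ N → a i < a (i + 2))
    -- `I 0 < I 1 < … < I μ` enumerates the (nonempty) set `𝒥`:
    (hImono : ∀ s t, s < t → t ≤ μ → I s < I t)
    (hIJ : ∀ i, (i ≤ N ∧ ((Finset.range (N + 1)).filter fun j => a j = a i).card = 1)
        ↔ ∃ s, s ≤ μ ∧ I s = i)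
    (hm : ∀ s, s < μ → I (s + 1) = I s + 2 * m s + 1)
    -- `X ⊆ {0,2,4,…} ∩ [0,μ-1]`:
    (X : Finset ℕ) (hX : ∀ s ∈ X, s % 2 = 0 ∧ s < μ)
    -- `aX` is the sequence `a^X`:
    (aX : ℕ → ℕ)
    (haX : ∀ s ∈ X, ∀ k ≤ m s, aX (I s + 2 * k) = a (I s + 2 * k + 1)
        ∧ aX (I s + 2 * k + 1) = a (I s + 2 * k))
    (haX' : ∀ i ≤ N, (∀ s ∈ X, ¬ (I s ≤ i ∧ i ≤ I s + 2 * m s + 1)) → aX i = a i) :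
    -- `a^X ∈ ℰ`:
    ((∀ i, i + 2 ≤ N → aX i < aX (i + 2))
      ∧ (Multiset.range (N + 1)).map aX = (Multiset.range (N + 1)).map a)
    -- `[a°^X] = [a°]`:
    ∧ (Multiset.range (N + 1)).map (fun i => aX i + i / 2)
        = (Multiset.range (N + 1)).map (fun i => a i + i / 2) := by
  have hJ : ∀ s ≤ μ, I s ≤ N ∧
      ((Finset.range (N + 1)).filter fun j => a j = a (I s)).card = 1 :=
    fun s hs => (hIJ (I s)).2 ⟨s, hs, rfl⟩
  have hI0 : I 0 % 2 = 0 := by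
    obtain ⟨h1, h2⟩ := hJ 0 (Nat.zero_le _)
    refine even_of_first_singleton hmono hstrict h1 h2 fun i hi hc => ?_
    obtain ⟨s, hs, rfl⟩ := (hIJ i).1 ⟨by omega, hc⟩
    rcases Nat.eq_zero_or_pos s with rfl | hpos
    · omega
    · have := hImono 0 s hpos hs
      omega
  have hpar : ∀ s ≤ μ, I s % 2 = s % 2 := by
    intro s
    induction s with
    | zero => intro _; omega
    | succ s ih =>
      intro hs
      have h1 := ih (by omega)
      have h2 := hm s (by omega)
      omega
  have hbefore : ∀ s ≤ μ, ∀ j, j + 1 = I s → a j < a (I s) := by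
    intro s hs j hj
    obtain ⟨h1, h2⟩ := hJ s hs
    have h3 := hmono j (by omega)
    rw [hj] at h3
    refine lt_of_le_of_ne h3 fun h => ?_
    have := eq_of_card_filter_eq_one h2 h1 (by omega) h
    omega
  have hafter : ∀ s ≤ μ, I s + 1 ≤ N → a (I s) < a (I s + 1) := by
    intro s hs hN
    obtain ⟨h1, h2⟩ := hJ s hs
    refine lt_of_le_of_ne (hmono _ hN) fun h => ?_
    have := eq_of_card_filter_eq_one h2 h1 hN h.symm
    omega
  let S : ℕ → Prop := fun i => ∃ s ∈ X, I s ≤ i ∧ i ≤ I s + 2 * m s + 1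
  have hblock : ∀ s ∈ X, I s % 2 = 0 ∧ I s + 2 * m s + 1 ≤ N := by
    intro s hs
    obtain ⟨h1, h2⟩ := hX s hs
    have h3 := hpar s h2.le
    have h4 := hm s h2
    have h5 := (hJ (s + 1) h2).1
    omega
  have hS : ∀ e, e % 2 = 0 → (S e ↔ S (e + 1)) := by
    intro e he
    constructor
    · rintro ⟨s, hs, h1, h2⟩
      have := hblock s hs
      exact ⟨s, hs, by omega, by omega⟩
    · rintro ⟨s, hs, h1, h2⟩
      have := hblock s hs
      exact ⟨s, hs, by omega, by omega⟩
  have hSN : ∀ e, e % 2 = 0 → S e → e + 1 ≤ N := by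
    rintro e he ⟨s, hs, h1, h2⟩
    have := hblock s hs
    omega
  have hswap : ∀ e, e % 2 = 0 → S e → aX e = a (e + 1) ∧ aX (e + 1) = a e := by
    rintro e he ⟨s, hs, h1, h2⟩
    have hb := hblock s hs
    have h := haX s hs ((e - I s) / 2) (by omega)
    rwa [show I s + 2 * ((e - I s) / 2) = e by omega] at h
  have hfix : ∀ i ≤ N, ¬ S i → aX i = a i := fun i hi h =>
    haX' i hi fun s hs hsi => h ⟨s, hs, hsi⟩
  have hle : ∀ i ≤ N, pairSwap S i ≤ N := by
    intro i hi
    unfold pairSwap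
    split_ifs with h1 h2
    · exact hSN i h2 h1
    · omega
    · exact hi
  have haXσ : ∀ i ≤ N, aX i = a (pairSwap S i) := by
    intro i hi
    unfold pairSwap
    split_ifs with h1 h2
    · exact (hswap i h2 h1).1
    · obtain ⟨e, rfl⟩ : ∃ e, i = e + 1 := ⟨i - 1, by omega⟩
      have he : e % 2 = 0 := by omega
      exact (hswap e he ((hS e he).2 h1)).2
    · exact hfix i hi h1
  -- at either end of a block, the adjacent values are distinct
  have hborder : ∀ e, e % 2 = 0 → e + 2 ≤ N → ¬ (S e ↔ S (e + 2)) → a (e + 1) < a (e + 2) := by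
    intro e he hN hne
    by_cases h : S e
    · obtain ⟨s, hs, h1, h2⟩ := h
      have h3 : ¬ S (e + 2) := fun h => hne ⟨fun _ => h, fun _ => ⟨s, hs, h1, h2⟩⟩
      have hb := hblock s hs
      have h4 : e + 1 = I (s + 1) := by
        rw [hm s (hX s hs).2]
        by_contra h5
        exact h3 ⟨s, hs, by omega, by omega⟩
      have := hafter (s + 1) (hX s hs).2 (by omega)
      rwa [← h4] at this
    · obtain ⟨s, hs, h1, h2⟩ : S (e + 2) := by
        by_contra h'
        exact hne ⟨fun x => absurd x h, fun x => absurd x h'⟩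
      have hb := hblock s hs
      have h4 : e + 2 = I s := by
        by_contra h5
        exact h ⟨s, hs, by omega, by omega⟩
      have := hbefore s (hX s hs).2.le (e + 1) h4
      rwa [← h4] at this
  clear_value S
  refine ⟨⟨fun i hi => ?_, ?_⟩, ?_⟩
  · rcases Nat.mod_two_eq_zero_or_one i with he | ho
    · have he2 : (i + 2) % 2 = 0 := by omega
      have h1 := hstrict i hi
      by_cases hSi : S i <;> by_cases hSi2 : S (i + 2)
      · rw [(hswap i he hSi).1, (hswap _ he2 hSi2).1]
        exact hstrict (i + 1) (hSN _ he2 hSi2)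
      · rw [(hswap i he hSi).1, hfix _ hi hSi2]
        exact hborder i he hi fun h => hSi2 (h.1 hSi)
      · rw [hfix i (by omega) hSi, (hswap _ he2 hSi2).1]
        exact h1.trans_le (hmono (i + 2) (hSN _ he2 hSi2))
      · rwa [hfix i (by omega) hSi, hfix _ hi hSi2]
    · obtain ⟨e, rfl⟩ : ∃ e, i = e + 1 := ⟨i - 1, by omega⟩
      have he : e % 2 = 0 := by omega
      have he2 : (e + 2) % 2 = 0 := by omega
      have h1 := hstrict e (by omega)
      have h2 : e + 1 + 2 = e + 2 + 1 := by omega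
      rw [h2] at hi ⊢
      by_cases hSi : S e <;> by_cases hSi2 : S (e + 2)
      · rwa [(hswap e he hSi).2, (hswap _ he2 hSi2).2]
      · rw [(hswap e he hSi).2, hfix _ hi (fun h => hSi2 ((hS _ he2).2 h))]
        exact h1.trans_le (hmono _ hi)
      · rw [hfix (e + 1) (by omega) (fun h => hSi ((hS _ he).2 h)), (hswap _ he2 hSi2).2]
        exact hborder e he (by omega) fun h => hSi (h.2 hSi2)
      · rw [hfix (e + 1) (by omega) (fun h => hSi ((hS _ he).2 h)),
          hfix _ hi (fun h => hSi2 ((hS _ he2).2 h))]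
        exact hstrict (e + 1) hi
  · exact map_range_eq_of_involution N _ _ (pairSwap S) hle
      (fun i _ => pairSwap_pairSwap hS i) haXσ
  · refine map_range_eq_of_involution N _ _ (pairSwap S) hle
      (fun i _ => pairSwap_pairSwap hS i) fun i hi => ?_
    rw [haXσ i hi, pairSwap_div_two]
end

section
/- (Lemma 2.2) In Setup (§2): if b ∈ ℰ satisfies [b°] = [a°] as multisets, then b = a^X for some subset X ⊆ {0,2,4,…} ∩ [0,μ−1]. -/
theorem Multiset.eq_of_add_eq_add_of_forall_le {α : Type*} [LinearOrder α]
    {s t s' t' : Multiset α}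
    (h : s + t = s' + t') (hcard : s.card = s'.card)
    (hst : ∀ x ∈ s, ∀ y ∈ t, x ≤ y) (hst' : ∀ x ∈ s', ∀ y ∈ t', x ≤ y) : s = s' := by
  have key : ∀ u v : Multiset α, (∀ x ∈ u, ∀ y ∈ v, x ≤ y) →
      (u.sort (· ≤ ·) ++ v.sort (· ≤ ·)).Pairwise (· ≤ ·) := by
    intro u v huv
    rw [List.pairwise_append]
    refine ⟨u.pairwise_sort _, v.pairwise_sort _, ?_⟩
    intro x hx y hy
    exact huv x ((Multiset.mem_sort _).1 hx) y ((Multiset.mem_sort _).1 hy)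
  have hperm : (s.sort (· ≤ ·) ++ t.sort (· ≤ ·)).Perm
      (s'.sort (· ≤ ·) ++ t'.sort (· ≤ ·)) := by
    rw [← Multiset.coe_eq_coe, ← Multiset.coe_add, ← Multiset.coe_add]
    simpa using h
  have heq := hperm.eq_of_pairwise' (key s t hst) (key s' t' hst')
  have hs := (List.append_inj heq (by simpa using hcard)).1
  rw [← Multiset.sort_eq s (· ≤ ·), hs, Multiset.sort_eq]

theorem Multiset.map_range_eq_coe_ofFn {α : Type*} (f : ℕ → α) (n : ℕ) :
    (Multiset.range n).map f = (List.ofFn fun i : Fin n => f i : Multiset α) := by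
  rw [← Multiset.coe_range, Multiset.map_coe, List.ofFn_eq_map, ← List.map_coe_finRange_eq_range,
    List.map_map]
  rfl

/-- A rearrangement of a monotone sequence is the sequence composed with a permutation. -/
theorem exists_perm_of_map_range_eq {n : ℕ} {a b : ℕ → ℕ}
    (ha : Monotone fun i : Fin n => a i)
    (h : (Multiset.range n).map b = (Multiset.range n).map a) :
    ∃ σ : Equiv.Perm (Fin n), ∀ i : Fin n, b i = a (σ i) := by
  set f : Fin n → ℕ := fun i => b i with hf
  rw [Multiset.map_range_eq_coe_ofFn, Multiset.map_range_eq_coe_ofFn, Multiset.coe_eq_coe] at h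
  have hp := ((Tuple.sort f).ofFn_comp_perm f).trans h
  have heq := hp.eq_of_pairwise' (Tuple.monotone_sort f).sortedLE_ofFn.pairwise
    ha.sortedLE_ofFn.pairwise
  have hfun := List.ofFn_injective heq
  refine ⟨(Tuple.sort f).symm, fun i => ?_⟩
  have := congrFun hfun ((Tuple.sort f).symm i)
  simpa [hf] using this

/-- If shifting by `c` preserves the equality of the multisets of values, then a rearrangement
of a monotone sequence varies together with the monotone shift `c`. -/
theorem le_of_map_range_add_eq {n : ℕ} {a b c : ℕ → ℕ}
    (ha : Monotone fun i : Fin n => a i) (hc : Monotone c)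
    (h : (Multiset.range n).map b = (Multiset.range n).map a)
    (hadd : (Multiset.range n).map (fun i => b i + c i)
      = (Multiset.range n).map (fun i => a i + c i))
    {i j : ℕ} (hi : i < n) (hj : j < n) (hij : c i < c j) : b i ≤ b j := by
  obtain ⟨σ, hσ⟩ := exists_perm_of_map_range_eq ha h
  have hsq : ∀ f g : ℕ → ℕ, (Multiset.range n).map f = (Multiset.range n).map g →
      ∑ i ∈ Finset.range n, f i ^ 2 = ∑ i ∈ Finset.range n, g i ^ 2 := by
    intro f g hfg
    have := congrArg (fun s => (s.map (· ^ 2)).sum) hfg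
    simpa [Finset.sum, Multiset.map_map, Function.comp_def] using this
  have h1 := hsq _ _ h
  have h2 := hsq _ _ hadd
  have h3 : ∑ i ∈ Finset.range n, b i * c i = ∑ i ∈ Finset.range n, a i * c i := by
    simp only [add_sq, Finset.sum_add_distrib, mul_assoc, ← Finset.mul_sum] at h2
    omega
  rw [Finset.sum_range, Finset.sum_range] at h3
  simp only [hσ] at h3
  have hmv : Monovary (fun i : Fin n => a i) (fun i : Fin n => c i) :=
    ha.monovary fun x y hxy => hc hxy
  have := (hmv.sum_comp_perm_mul_eq_sum_mul_iff (σ := σ)).1 h3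
  have := @this ⟨i, hi⟩ ⟨j, hj⟩ hij
  simpa [← hσ] using this

theorem map_range_eq_of_le {n k : ℕ} {a b : ℕ → ℕ} (hk : k ≤ n)
    (h : (Multiset.range n).map b = (Multiset.range n).map a)
    (ha : ∀ i < k, ∀ j, k ≤ j → j < n → a i ≤ a j)
    (hb : ∀ i < k, ∀ j, k ≤ j → j < n → b i ≤ b j) :
    (Multiset.range k).map b = (Multiset.range k).map a := by
  obtain ⟨d, rfl⟩ := Nat.exists_eq_add_of_le hk
  rw [Multiset.range_add, Multiset.map_add, Multiset.map_add] at h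
  refine Multiset.eq_of_add_eq_add_of_forall_le h (by simp) ?_ ?_
  · simp only [Multiset.mem_map, Multiset.mem_range]
    rintro _ ⟨i, hi, rfl⟩ _ ⟨_, ⟨j, hj, rfl⟩, rfl⟩
    exact hb i hi _ (by omega) (by omega)
  · simp only [Multiset.mem_map, Multiset.mem_range]
    rintro _ ⟨i, hi, rfl⟩ _ ⟨_, ⟨j, hj, rfl⟩, rfl⟩
    exact ha i hi _ (by omega) (by omega)

theorem block_eq_or_swap {N : ℕ} {a b : ℕ → ℕ}
    (ha : ∀ i j, i ≤ j → j ≤ N → a i ≤ a j)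
    (h : (Multiset.range (N + 1)).map b = (Multiset.range (N + 1)).map a)
    (hcirc : (Multiset.range (N + 1)).map (fun i => b i + i / 2)
        = (Multiset.range (N + 1)).map (fun i => a i + i / 2)) :
    (∀ k, 2 * k + 1 ≤ N → (b (2 * k) = a (2 * k) ∧ b (2 * k + 1) = a (2 * k + 1)) ∨
      (b (2 * k) = a (2 * k + 1) ∧ b (2 * k + 1) = a (2 * k))) ∧
    (∀ k, 2 * k = N → b (2 * k) = a (2 * k)) := by
  have hle : ∀ i j, i / 2 < j / 2 → j ≤ N → b i ≤ b j := by
    intro i j hij hj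
    refine le_of_map_range_add_eq (n := N + 1) (c := fun i => i / 2) ?_ ?_ h hcirc
      (by omega) (by omega) hij
    · intro x y hxy
      exact ha x y hxy (by omega)
    · intro x y hxy
      exact Nat.div_le_div_right hxy
  have hpre : ∀ k, 2 * k ≤ N + 1 →
      (Multiset.range (2 * k)).map b = (Multiset.range (2 * k)).map a := by
    intro k hk
    refine map_range_eq_of_le hk h ?_ ?_
    · intro i hi j hj hjn
      exact ha i j (by omega) (by omega)
    · intro i hi j hj hjn
      exact hle i j (by omega) (by omega)
  constructor
  · intro k hk
    have h0 := hpre k (by omega)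
    have h1 := hpre (k + 1) (by omega)
    rw [show 2 * (k + 1) = 2 * k + 1 + 1 by ring] at h1
    simp only [Multiset.range_succ, Multiset.map_cons, h0] at h1
    rw [← Multiset.singleton_add, ← Multiset.singleton_add, ← Multiset.singleton_add,
      ← Multiset.singleton_add, ← add_assoc, ← add_assoc] at h1
    have h2 := add_right_cancel h1
    rw [Multiset.singleton_add, Multiset.singleton_add] at h2
    have h3 := Multiset.cons_eq_cons.1 h2
    simp only [Multiset.singleton_inj] at h3
    rcases h3 with h3 | ⟨-, cs, h4, h5⟩
    · exact Or.inl ⟨h3.2, h3.1⟩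
    · rw [Multiset.singleton_eq_cons_iff] at h4 h5
      exact Or.inr ⟨h4.1, h5.1.symm⟩
  · rintro k rfl
    have h0 := hpre k (by omega)
    simp only [Multiset.range_succ, Multiset.map_cons, h0] at h
    simpa using h

theorem exists_adjacent_eq {N : ℕ} {a : ℕ → ℕ}
    (ha : ∀ i j, i ≤ j → j ≤ N → a i ≤ a j) {p : ℕ} (hp : p ≤ N)
    (hcard : ((Finset.range (N + 1)).filter fun j => a j = a p).card ≠ 1) :
    (∃ q, q + 1 = p ∧ a q = a p) ∨ (p + 1 ≤ N ∧ a (p + 1) = a p) := by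
  by_contra! hne
  obtain ⟨h1, h2⟩ := hne
  apply hcard
  rw [Finset.card_eq_one]
  refine ⟨p, ?_⟩
  ext j
  simp only [Finset.mem_filter, Finset.mem_range, Finset.mem_singleton]
  constructor
  · rintro ⟨hj, hjp⟩
    by_contra hne
    rcases Nat.lt_or_gt_of_ne hne with hlt | hlt
    · obtain ⟨q, rfl⟩ : ∃ q, q + 1 = p := ⟨p - 1, by omega⟩
      have := h1 q rfl
      have := ha j q (by omega) (by omega)
      have := ha q (q + 1) (by omega) (by omega)
      omega
    · have := h2 (by omega)
      have := ha (p + 1) j (by omega) (by omega)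
      have := ha p (p + 1) (by omega) (by omega)
      omega
  · rintro rfl
    exact ⟨by omega, rfl⟩

theorem card_filter_ne_one {N : ℕ} {a : ℕ → ℕ} {p q : ℕ} (hp : p ≤ N) (hq : q ≤ N)
    (hpq : p ≠ q) (h : a q = a p) :
    ((Finset.range (N + 1)).filter fun j => a j = a p).card ≠ 1 := by
  intro hc
  obtain ⟨x, hx⟩ := Finset.card_eq_one.1 hc
  have h1 : p ∈ (Finset.range (N + 1)).filter fun j => a j = a p := by simp; omega
  have h2 : q ∈ (Finset.range (N + 1)).filter fun j => a j = a p := by simp [h]; omega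
  rw [hx, Finset.mem_singleton] at h1 h2
  omega

/-- The `k`-th pair of entries of `a` is strictly increasing and is interchanged in `b`. -/
def Swapped (N : ℕ) (a b : ℕ → ℕ) (k : ℕ) : Prop :=
  2 * k + 1 ≤ N ∧ a (2 * k) < a (2 * k + 1) ∧ b (2 * k) = a (2 * k + 1) ∧
    b (2 * k + 1) = a (2 * k)

theorem Swapped.exists_left {N : ℕ} {a b : ℕ → ℕ} {P : ℕ → Prop}
    (hadj : ∀ p ≤ N, ¬ P p → (∃ q, q + 1 = p ∧ a q = a p) ∨ (p + 1 ≤ N ∧ a (p + 1) = a p))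
    (hP : ∀ p, p + 1 ≤ N → a p = a (p + 1) → ¬ P p ∧ ¬ P (p + 1))
    (hstrict : ∀ i, i + 2 ≤ N → a i < a (i + 2))
    (hbstrict : ∀ i, i + 2 ≤ N → b i < b (i + 2))
    (hblock : ∀ k, 2 * k + 1 ≤ N → (b (2 * k) = a (2 * k) ∧ b (2 * k + 1) = a (2 * k + 1)) ∨
      (b (2 * k) = a (2 * k + 1) ∧ b (2 * k + 1) = a (2 * k)))
    (k : ℕ) (hk : Swapped N a b k) :
    ∃ l ≤ k, P (2 * l) ∧ Swapped N a b l ∧ ∀ p, 2 * l < p → p ≤ 2 * k → ¬ P p := by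
  induction k with
  | zero =>
    refine ⟨0, le_rfl, ?_, hk, fun p h1 h2 => by omega⟩
    obtain ⟨h1, h2, -⟩ := hk
    by_contra h0
    rcases hadj _ (by omega) h0 with ⟨q, hq, -⟩ | ⟨-, h⟩
    · omega
    · omega
  | succ k ih =>
    by_cases h0 : P (2 * (k + 1))
    · exact ⟨k + 1, le_rfl, h0, hk, fun p h1 h2 => by omega⟩
    obtain ⟨h1, h2, h3, h4⟩ := hk
    rcases hadj _ (by omega) h0 with ⟨q, hq, he⟩ | ⟨-, h⟩
    · obtain rfl : q = 2 * k + 1 := by omega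
      rw [show 2 * (k + 1) = 2 * k + 2 by ring] at *
      have hs := hstrict (2 * k) (by omega)
      have hb := hbstrict (2 * k + 1) (by omega)
      rw [show 2 * k + 1 + 2 = 2 * k + 2 + 1 by ring] at hb
      have hsw : Swapped N a b k := by
        rcases hblock k (by omega) with h | h
        · omega
        · exact ⟨by omega, by omega, h.1, h.2⟩
      obtain ⟨l, hl, hPl, hsl, hn⟩ := ih hsw
      refine ⟨l, by omega, hPl, hsl, fun p hp1 hp2 => ?_⟩
      have := hP (2 * k + 1) (by omega) he
      rcases (by omega : p ≤ 2 * k ∨ p = 2 * k + 1 ∨ p = 2 * k + 1 + 1) with h | rfl | rfl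
      · exact hn p hp1 h
      · exact this.1
      · exact this.2
    · omega

theorem Swapped.exists_right {N : ℕ} {a b : ℕ → ℕ} {P : ℕ → Prop}
    (hadj : ∀ p ≤ N, ¬ P p → (∃ q, q + 1 = p ∧ a q = a p) ∨ (p + 1 ≤ N ∧ a (p + 1) = a p))
    (hP : ∀ p, p + 1 ≤ N → a p = a (p + 1) → ¬ P p ∧ ¬ P (p + 1))
    (hstrict : ∀ i, i + 2 ≤ N → a i < a (i + 2))
    (hbstrict : ∀ i, i + 2 ≤ N → b i < b (i + 2))
    (hblock : ∀ k, 2 * k + 1 ≤ N → (b (2 * k) = a (2 * k) ∧ b (2 * k + 1) = a (2 * k + 1)) ∨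
      (b (2 * k) = a (2 * k + 1) ∧ b (2 * k + 1) = a (2 * k)))
    (hlast : ∀ k, 2 * k = N → b (2 * k) = a (2 * k))
    (k : ℕ) (hk : Swapped N a b k) :
    ∃ r, k ≤ r ∧ P (2 * r + 1) ∧ (∀ j, k ≤ j → j ≤ r → Swapped N a b j) ∧
      ∀ p, 2 * k < p → p < 2 * r + 1 → ¬ P p := by
  induction hd : N - k generalizing k with
  | zero =>
    have := hk.1
    omega
  | succ d ih =>
    by_cases h0 : P (2 * k + 1)
    · refine ⟨k, le_rfl, h0, fun j h1 h2 => ?_, fun p h1 h2 => by omega⟩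
      obtain rfl : j = k := by omega
      exact hk
    obtain ⟨h1, h2, h3, h4⟩ := id hk
    rcases hadj _ h1 h0 with ⟨q, hq, he⟩ | ⟨hN, he⟩
    · obtain rfl : q = 2 * k := by omega
      omega
    have hb := hbstrict (2 * k) hN
    have hsw : Swapped N a b (k + 1) := by
      rcases Nat.eq_or_lt_of_le hN with hN' | hN'
      · have := hlast (k + 1) (by omega)
        rw [show 2 * (k + 1) = 2 * k + 2 by ring] at this
        rw [show 2 * k + 1 + 1 = 2 * k + 2 by ring] at he
        omega
      · have hs := hstrict (2 * k + 1) (by omega)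
        have hbl := hblock (k + 1) (by omega)
        unfold Swapped
        rw [show 2 * (k + 1) = 2 * k + 2 by ring] at *
        rw [show 2 * k + 1 + 1 = 2 * k + 2 by ring] at he
        rw [show 2 * k + 1 + 2 = 2 * k + 2 + 1 by ring] at hs
        omega
    obtain ⟨r, hr, hPr, hsr, hn⟩ := ih (k + 1) hsw (by omega)
    refine ⟨r, by omega, hPr, fun j hj1 hj2 => ?_, fun p hp1 hp2 => ?_⟩
    · rcases Nat.eq_or_lt_of_le hj1 with rfl | hj
      · exact hk
      · exact hsr j hj hj2
    · have := hP (2 * k + 1) hN he.symm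
      rcases (by omega : p = 2 * k + 1 ∨ p = 2 * k + 1 + 1 ∨ 2 * (k + 1) < p) with rfl | rfl | h
      · exact this.1
      · exact this.2
      · exact hn p h hp2

/-- The first position satisfying `P` is even, provided that failure of `P` at a position means
that the entry there equals a neighbouring one. -/
theorem even_of_first {N : ℕ} {a : ℕ → ℕ} {P : ℕ → Prop}
    (hadj : ∀ p ≤ N, ¬ P p → (∃ q, q + 1 = p ∧ a q = a p) ∨ (p + 1 ≤ N ∧ a (p + 1) = a p))
    (hP : ∀ p, p + 1 ≤ N → a p = a (p + 1) → ¬ P p ∧ ¬ P (p + 1))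
    (hstrict : ∀ i, i + 2 ≤ N → a i < a (i + 2))
    {p : ℕ} (hp : p ≤ N) (hPp : P p) (hfirst : ∀ q < p, ¬ P q) : p % 2 = 0 := by
  have key : ∀ j, 2 * j < p → 2 * j + 1 ≤ N ∧ a (2 * j + 1) = a (2 * j) := by
    intro j
    induction j with
    | zero =>
      intro hj
      rcases hadj _ (by omega) (hfirst _ hj) with ⟨q, hq, -⟩ | h
      · omega
      · exact h
    | succ j ih =>
      intro hj
      rcases hadj _ (by omega) (hfirst _ hj) with ⟨q, hq, he⟩ | h
      · obtain rfl : q = 2 * j + 1 := by omega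
        have h1 := ih (by omega)
        have h2 := hstrict (2 * j) (by omega)
        rw [show 2 * (j + 1) = 2 * j + 2 by ring] at he
        omega
      · exact h
  by_contra hodd
  obtain ⟨j, rfl⟩ : ∃ j, p = 2 * j + 1 := ⟨p / 2, by omega⟩
  have h := key j (by omega)
  exact (hP _ h.1 h.2.symm).2 hPp

/-- Lemma 2.2, Setup §2: if `b ∈ ℰ` satisfies `[b°] = [a°]` as
multisets (where `b°_i = b_i + ⌊i/2⌋`), then `b = a^X` for some subset
`X ⊆ {0,2,4,…} ∩ [0,μ-1]`. -/
theorem stmt_12 (N μ : ℕ) (a I m : ℕ → ℕ)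
    (hμ : μ % 2 = N % 2)
    (hmono : ∀ i, i + 1 ≤ N → a i ≤ a (i + 1))
    (hstrict : ∀ i, i + 2 ≤ N → a i < a (i + 2))
    (hImono : ∀ s t, s < t → t ≤ μ → I s < I t)
    (hIJ : ∀ i, (i ≤ N ∧ ((Finset.range (N + 1)).filter fun j => a j = a i).card = 1)
        ↔ ∃ s, s ≤ μ ∧ I s = i)
    (hm : ∀ s, s < μ → I (s + 1) = I s + 2 * m s + 1)
    -- `b ∈ ℰ`:
    (b : ℕ → ℕ)
    (hbstrict : ∀ i, i + 2 ≤ N → b i < b (i + 2))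
    (hbmult : (Multiset.range (N + 1)).map b = (Multiset.range (N + 1)).map a)
    -- `[b°] = [a°]`:
    (hbcirc : (Multiset.range (N + 1)).map (fun i => b i + i / 2)
        = (Multiset.range (N + 1)).map (fun i => a i + i / 2)) :
    ∃ X : Finset ℕ, (∀ s ∈ X, s % 2 = 0 ∧ s < μ)
      ∧ (∀ s ∈ X, ∀ k ≤ m s, b (I s + 2 * k) = a (I s + 2 * k + 1)
          ∧ b (I s + 2 * k + 1) = a (I s + 2 * k))
      ∧ (∀ i ≤ N, (∀ s ∈ X, ¬ (I s ≤ i ∧ i ≤ I s + 2 * m s + 1)) → b i = a i) := by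
  classical
  have ha : ∀ i j, i ≤ j → j ≤ N → a i ≤ a j := by
    intro i j hij
    induction hij with
    | refl => exact fun _ => le_rfl
    | step _ ih => exact fun h => (ih (by omega)).trans (hmono _ h)
  obtain ⟨hblock, hlast⟩ := block_eq_or_swap ha hbmult hbcirc
  set P : ℕ → Prop := fun i => ∃ s, s ≤ μ ∧ I s = i with hPdef
  have hPI : ∀ s ≤ μ, P (I s) := fun s hs => ⟨s, hs, rfl⟩
  have hadj : ∀ p ≤ N, ¬ P p →
      (∃ q, q + 1 = p ∧ a q = a p) ∨ (p + 1 ≤ N ∧ a (p + 1) = a p) := by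
    intro p hp hPp
    refine exists_adjacent_eq ha hp fun hc => hPp ((hIJ p).1 ⟨hp, hc⟩)
  have hP : ∀ p, p + 1 ≤ N → a p = a (p + 1) → ¬ P p ∧ ¬ P (p + 1) := by
    intro p hp he
    exact ⟨fun h => card_filter_ne_one (by omega) hp (by omega) he.symm ((hIJ _).2 h).2,
      fun h => card_filter_ne_one hp (by omega) (by omega) he ((hIJ _).2 h).2⟩
  have hinj : ∀ s t, s ≤ μ → t ≤ μ → I s < I t → s < t := by
    intro s t hs ht hst
    by_contra hn
    rcases Nat.eq_or_lt_of_le (not_lt.1 hn) with rfl | h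
    · omega
    · have := hImono t s h hs
      omega
  have hI0 : I 0 % 2 = 0 := by
    refine even_of_first hadj hP hstrict ((hIJ _).2 (hPI 0 (Nat.zero_le _))).1
      (hPI 0 (Nat.zero_le _)) ?_
    rintro _ hq ⟨s, hs, rfl⟩
    have := hinj s 0 hs (Nat.zero_le _) hq
    omega
  have hIpar : ∀ s ≤ μ, I s % 2 = s % 2 := by
    intro s
    induction s with
    | zero => exact fun _ => hI0
    | succ s ih =>
      intro hs
      have := ih (by omega)
      have := hm s hs
      omega
  -- the next element of `P` after `I s` is `I (s + 1)`
  have hnext : ∀ s ≤ μ, ∀ p, P p → I s < p → (∀ q, I s < q → q < p → ¬ P q) →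
      s < μ ∧ I s + 2 * m s + 1 = p := by
    rintro s hs _ ⟨t, ht, rfl⟩ hlt hno
    have hst := hinj s t hs ht hlt
    have hsμ : s < μ := by omega
    refine ⟨hsμ, ?_⟩
    rw [← hm s hsμ]
    rcases Nat.eq_or_lt_of_le hst with rfl | h
    · rfl
    · exact absurd (hPI (s + 1) hsμ)
        (hno _ (hImono _ _ (Nat.lt_succ_self s) hsμ) (hImono _ _ h ht))
  refine ⟨(Finset.range μ).filter fun s => s % 2 = 0 ∧ Swapped N a b (I s / 2), ?_, ?_, ?_⟩
  · intro s hs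
    simp only [Finset.mem_filter, Finset.mem_range] at hs
    exact ⟨hs.2.1, hs.1⟩
  · intro s hs k hk
    simp only [Finset.mem_filter, Finset.mem_range] at hs
    obtain ⟨hsμ, hs0, hsw⟩ := hs
    obtain ⟨r, hr, hPr, hall, hno⟩ :=
      Swapped.exists_right hadj hP hstrict hbstrict hblock hlast _ hsw
    have hpar := hIpar s hsμ.le
    have hhalf : 2 * (I s / 2) = I s := by omega
    rw [hhalf] at hno
    have hn := (hnext s hsμ.le _ hPr (by omega) hno).2
    have hj := hall (I s / 2 + k) (by omega) (by omega)
    obtain ⟨-, -, h3, h4⟩ := hj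
    rw [show 2 * (I s / 2 + k) = I s + 2 * k by omega] at h3 h4
    exact ⟨h3, h4⟩
  · intro i hi hX
    by_contra hne
    have hsw : Swapped N a b (i / 2) := by
      rcases (by omega : 2 * (i / 2) + 1 ≤ N ∨ (2 * (i / 2) = N ∧ i = 2 * (i / 2))) with h | h
      · have hle := hmono _ h
        rcases (by omega : i = 2 * (i / 2) ∨ i = 2 * (i / 2) + 1) with h' | h'
        all_goals
          rw [h'] at hne
          have hbl := hblock _ h
          generalize i / 2 = k at *
          subst h'
          unfold Swapped
          omega
      · exact absurd (h.2 ▸ hlast _ h.1) hne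
    obtain ⟨l, hl, hPl, hswl, hnol⟩ :=
      Swapped.exists_left hadj hP hstrict hbstrict hblock _ hsw
    obtain ⟨r, hr, hPr, -, hnor⟩ :=
      Swapped.exists_right hadj hP hstrict hbstrict hblock hlast _ hsw
    obtain ⟨s, hs, hsl⟩ := hPl
    have hpar := hIpar s hs
    obtain ⟨hsμ, hn⟩ := hnext s hs _ hPr (by omega) fun q h1 h2 => by
      rcases le_or_gt q (2 * (i / 2)) with h | h
      · exact hnol q (by omega) h
      · exact hnor q h h2
    refine hX s ?_ ⟨by omega, by omega⟩
    simp only [Finset.mem_filter, Finset.mem_range]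
    refine ⟨hsμ, by omega, ?_⟩
    rwa [show I s / 2 = l by omega]
end

section
/- In Setup (§2): assume μ ≥ 1 and let b ∈ ℰ satisfy [b°] = [a°] as multisets. Then exactly one of the following holds on the block of indices [i_0, i_1]: either b_i = a_i for all i ∈ [i_0, i_1], or b_{i_0+2k} = a_{i_0+2k+1} and b_{i_0+2k+1} = a_{i_0+2k} for all 0 ≤ k ≤ m_0. -/
open Finset in
theorem card_filter_range_eq_of_map_eq {n : ℕ} {f g : ℕ → ℕ}
    (h : (Multiset.range n).map f = (Multiset.range n).map g)
    (P : ℕ → Prop) [DecidablePred P] :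
    #{i ∈ range n | P (f i)} = #{i ∈ range n | P (g i)} := by
  have := congrArg (Multiset.countP P) h
  rw [Multiset.countP_map, Multiset.countP_map] at this
  exact this

theorem monotone_upto {N : ℕ} {a : ℕ → ℕ} (h : ∀ i, i + 1 ≤ N → a i ≤ a (i + 1)) :
    ∀ i k, i ≤ k → k ≤ N → a i ≤ a k := by
  intro i k hik
  induction k, hik using Nat.le_induction with
  | base => intro _; rfl
  | succ k _ ih => intro hk; exact (ih (by omega)).trans (h k hk)

theorem add_le_of_two_step_strict {N : ℕ} {b : ℕ → ℕ}
    (h : ∀ i, i + 2 ≤ N → b i < b (i + 2)) :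
    ∀ i d, i + 2 * d ≤ N → b i + d ≤ b (i + 2 * d) := by
  intro i d
  induction d with
  | zero => intro _; simp
  | succ d ih =>
    intro hd
    have h1 := ih (by omega)
    have h2 := h (i + 2 * d) (by omega)
    rw [show i + 2 * (d + 1) = i + 2 * d + 2 by ring]
    omega

/-- A sequence increasing along each parity class which takes a value exactly twice takes it
once in each class. -/
theorem exists_of_card_eq_two {N v : ℕ} {b : ℕ → ℕ}
    (hb : ∀ i, i + 2 ≤ N → b i < b (i + 2))
    (hv : ((Finset.range (N + 1)).filter fun i => b i = v).card = 2) {ε : ℕ} (hε : ε ≤ 1) :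
    ∃ j, 2 * j + ε ≤ N ∧ b (2 * j + ε) = v := by
  have hs := add_le_of_two_step_strict hb
  have key : ∀ x y, x < y → y ≤ N → b x = v → b y = v →
      ∃ j, 2 * j + ε ≤ N ∧ b (2 * j + ε) = v := by
    intro x y hxy hy hbx hby
    have hpar : x % 2 ≠ y % 2 := by
      intro hp
      have := hs x ((y - x) / 2) (by omega)
      rw [show x + 2 * ((y - x) / 2) = y by omega] at this
      omega
    by_cases hx : x % 2 = ε
    · exact ⟨x / 2, by omega, by rw [show 2 * (x / 2) + ε = x by omega]; exact hbx⟩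
    · exact ⟨y / 2, by omega, by rw [show 2 * (y / 2) + ε = y by omega]; exact hby⟩
  obtain ⟨x, y, hxy, hset⟩ := Finset.card_eq_two.mp hv
  have hx : x ∈ (Finset.range (N + 1)).filter fun i => b i = v := by simp [hset]
  have hy : y ∈ (Finset.range (N + 1)).filter fun i => b i = v := by simp [hset]
  simp only [Finset.mem_filter, Finset.mem_range] at hx hy
  rcases lt_or_gt_of_ne hxy with h | h
  · exact key x y h (by omega) hx.2 hy.2
  · exact key y x h (by omega) hy.2 hx.2

theorem le_of_two_step_strict {N r : ℕ} {b v : ℕ → ℕ}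
    (hb : ∀ i, i + 2 ≤ N → b i < b (i + 2))
    (hgap : ∀ i ≤ N, ∀ j ≤ r, v j < b i → v (j + 1) ≤ b i)
    (h0 : ∀ i ≤ N, v 0 ≤ b i) {ε : ℕ} :
    ∀ j ≤ r + 1, 2 * j + ε ≤ N → v j ≤ b (2 * j + ε) := by
  intro j
  induction j with
  | zero => intro _ h; exact h0 _ h
  | succ j ih =>
    intro hj hN
    have h1 := ih (by omega) (by omega)
    have h2 := hb (2 * j + ε) (by omega)
    rw [show 2 * (j + 1) + ε = 2 * j + ε + 2 by ring] at hN ⊢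
    exact hgap _ hN j (by omega) (by omega)

/-- Along one parity class, each of the first `r + 1` terms of `b` is one of two consecutive
values of `v`. -/
theorem eq_or_eq_succ {N r : ℕ} {b v : ℕ → ℕ} (hr : 2 * r + 1 ≤ N)
    (hb : ∀ i, i + 2 ≤ N → b i < b (i + 2))
    (hgap : ∀ i ≤ N, ∀ j ≤ r, v j < b i → v (j + 1) ≤ b i)
    (h0 : ∀ i ≤ N, v 0 ≤ b i) {ε : ℕ} (hε : ε ≤ 1) (htop : b (2 * r + ε) ≤ v (r + 1)) :
    ∀ j ≤ r, b (2 * j + ε) = v j ∨ b (2 * j + ε) = v (j + 1) := by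
  have hlow := le_of_two_step_strict hb hgap h0 (ε := ε)
  have hup : ∀ d ≤ r, b (2 * (r - d) + ε) ≤ v (r - d + 1) := by
    intro d
    induction d with
    | zero => intro _; simpa using htop
    | succ d ih =>
      intro hd
      have h1 := ih (by omega)
      have h2 := hb (2 * (r - (d + 1)) + ε) (by omega)
      rw [show 2 * (r - (d + 1)) + ε + 2 = 2 * (r - d) + ε by omega] at h2
      by_contra hc
      have h3 := hgap (2 * (r - (d + 1)) + ε) (by omega) (r - (d + 1) + 1) (by omega) (by omega)
      rw [show r - (d + 1) + 1 + 1 = r - d + 1 by omega] at h3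
      omega
  intro j hj
  have h1 := hlow j (by omega) (by omega)
  have h2 := hup (r - j) (by omega)
  rw [show r - (r - j) = j by omega] at h2
  by_cases h : b (2 * j + ε) = v j
  · exact Or.inl h
  · have := hgap (2 * j + ε) (by omega) j hj (by omega)
    right; omega

/-- Along one parity class, `b` follows `v`, possibly with a shift by one starting at the
only value `v p` that may be skipped. -/
theorem eq_or_eq_succ_of_ge {N r p : ℕ} {b v : ℕ → ℕ} (hr : 2 * r + 1 ≤ N)
    (hb : ∀ i, i + 2 ≤ N → b i < b (i + 2))
    (hv : ∀ j ≤ r, v j < v (j + 1))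
    (hgap : ∀ i ≤ N, ∀ j ≤ r, v j < b i → v (j + 1) ≤ b i)
    (h0 : ∀ i ≤ N, v 0 ≤ b i) {ε : ℕ} (hε : ε ≤ 1) (htop : b (2 * r + ε) ≤ v (r + 1))
    (hocc : ∀ j ≤ r, j ≠ p → ∃ k, 2 * k + ε ≤ N ∧ b (2 * k + ε) = v j) :
    (∀ j < p, j ≤ r → b (2 * j + ε) = v j) ∧
      ((∀ j, p ≤ j → j ≤ r → b (2 * j + ε) = v j) ∨
        (∀ j, p ≤ j → j ≤ r → b (2 * j + ε) = v (j + 1))) := by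
  have hd := eq_or_eq_succ hr hb hgap h0 hε htop
  have hlow := le_of_two_step_strict hb hgap h0 (ε := ε)
  have hvm : ∀ i k, i ≤ k → k ≤ r + 1 → v i ≤ v k :=
    monotone_upto fun i hi => (hv i (by omega)).le
  have hloc : ∀ j ≤ r, j ≠ p → b (2 * j + ε) = v j ∨
      ∃ k, k + 1 = j ∧ b (2 * k + ε) = v j := by
    intro j hj hjp
    obtain ⟨k, hkN, hk⟩ := hocc j hj hjp
    have hvj := hv j hj
    have hkj : k ≤ j := by
      by_contra hc
      have h1 := hlow (j + 1) (by omega) (by omega)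
      have h2 := add_le_of_two_step_strict hb (2 * (j + 1) + ε) (k - (j + 1)) (by omega)
      rw [show 2 * (j + 1) + ε + 2 * (k - (j + 1)) = 2 * k + ε by omega] at h2
      omega
    rcases hkj.eq_or_lt with rfl | hlt
    · exact Or.inl hk
    · right
      refine ⟨k, ?_, hk⟩
      by_contra hc
      have h1 := hvm (k + 1 + 1) j (by omega) (by omega)
      have h2 := hv k (by omega)
      have h3 := hv (k + 1) (by omega)
      rcases hd k (by omega) with h | h <;> omega
  have hstep : ∀ j, j + 1 ≤ r → j + 1 ≠ p → b (2 * j + ε) = v j →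
      b (2 * (j + 1) + ε) = v (j + 1) := by
    intro j hj hjp h
    rcases hloc (j + 1) hj hjp with h' | ⟨k, hk, h'⟩
    · exact h'
    · obtain rfl : k = j := by omega
      have := hv k (by omega)
      omega
  refine ⟨?_, ?_⟩
  · intro j
    induction j with
    | zero =>
      intro hp _
      rcases hloc 0 (by omega) (by omega) with h | ⟨k, hk, _⟩
      · exact h
      · omega
    | succ j ih =>
      intro hp hjr
      exact hstep j hjr (by omega) (ih (by omega) (by omega))
  · by_cases hpr : p ≤ r
    swap
    · exact Or.inl fun j _ _ => by omega
    rcases hd p hpr with h | h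
    · left
      intro j hj
      induction j, hj using Nat.le_induction with
      | base => intro _; exact h
      | succ j hj ih => intro hjr; exact hstep j hjr (by omega) (ih (by omega))
    · right
      intro j hj
      induction j, hj using Nat.le_induction with
      | base => intro _; exact h
      | succ j hj ih =>
        intro hjr
        have h1 := ih (by omega)
        have h2 := hb (2 * j + ε) (by omega)
        rw [show 2 * j + ε + 2 = 2 * (j + 1) + ε by ring] at h2
        rcases hd (j + 1) hjr with h' | h'
        · omega
        · exact h'

/-- Comparing `[b°]` with `[a°]` up to `a°_q`, `q = 2 r + 1`, bounds the initial terms of `b`. -/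
theorem le_of_circ_eq {N r : ℕ} {a b : ℕ → ℕ} (hr : 2 * r + 1 ≤ N)
    (hmono : ∀ i, i + 1 ≤ N → a i ≤ a (i + 1))
    (hlate : ∀ i ≤ N, 2 * r + 2 ≤ i → a (2 * r + 1) ≤ b i)
    (hcirc : (Multiset.range (N + 1)).map (fun i => b i + i / 2)
        = (Multiset.range (N + 1)).map (fun i => a i + i / 2)) :
    ∀ i ≤ 2 * r + 1, b i + i / 2 ≤ a (2 * r + 1) + r := by
  have hc := card_filter_range_eq_of_map_eq hcirc (· ≤ a (2 * r + 1) + r)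
  have hA : Finset.range (2 * r + 2) ⊆
      (Finset.range (N + 1)).filter fun i => a i + i / 2 ≤ a (2 * r + 1) + r := by
    intro i hi
    simp only [Finset.mem_filter, Finset.mem_range] at hi ⊢
    have := monotone_upto hmono i (2 * r + 1) (by omega) hr
    omega
  have hB : ((Finset.range (N + 1)).filter fun i => b i + i / 2 ≤ a (2 * r + 1) + r) ⊆
      Finset.range (2 * r + 2) := by
    intro i hi
    simp only [Finset.mem_filter, Finset.mem_range] at hi ⊢
    by_contra h
    have := hlate i (by omega) (by omega)
    omega
  have hEq := Finset.eq_of_subset_of_card_le hB (hc ▸ Finset.card_le_card hA)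
  intro i hi
  have : i ∈ Finset.range (2 * r + 2) := by simp; omega
  rw [← hEq] at this
  exact (Finset.mem_filter.mp this).2

theorem eq_succ_or_eq_pred_of_card_ne_one {N i : ℕ} {a : ℕ → ℕ}
    (hmono : ∀ i, i + 1 ≤ N → a i ≤ a (i + 1))
    (hi : i ≤ N)
    (h : ((Finset.range (N + 1)).filter fun j => a j = a i).card ≠ 1) :
    (i + 1 ≤ N ∧ a i = a (i + 1)) ∨ ∃ k, k + 1 = i ∧ a k = a i := by
  have hm := monotone_upto hmono
  by_contra! hc
  apply h
  rw [Finset.card_eq_one]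
  refine ⟨i, ?_⟩
  ext j
  simp only [Finset.mem_filter, Finset.mem_range, Finset.mem_singleton]
  constructor
  · rintro ⟨hj, hji⟩
    by_contra hne
    rcases lt_or_gt_of_ne hne with hlt | hgt
    · have h1 := hm j (i - 1) (by omega) (by omega)
      have h2 := hm (i - 1) i (by omega) hi
      exact hc.2 (i - 1) (by omega) (by omega)
    · have h1 := hm i (i + 1) (by omega) (by omega)
      have h2 := hm (i + 1) j (by omega) (by omega)
      exact hc.1 (by omega) (by omega)
  · rintro rfl
    exact ⟨by omega, rfl⟩

theorem ne_of_card_eq_one {N i j : ℕ} {a : ℕ → ℕ}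
    (h : ((Finset.range (N + 1)).filter fun j => a j = a i).card = 1)
    (hi : i ≤ N) (hj : j ≤ N) (hij : j ≠ i) : a j ≠ a i := by
  intro he
  have hj' : j ∈ (Finset.range (N + 1)).filter fun j => a j = a i :=
    Finset.mem_filter.mpr ⟨Finset.mem_range.mpr (by omega), he⟩
  have hi' : i ∈ (Finset.range (N + 1)).filter fun j => a j = a i :=
    Finset.mem_filter.mpr ⟨Finset.mem_range.mpr (by omega), rfl⟩
  exact hij (Finset.card_le_one.mp h.le j hj' i hi')

theorem card_eq_two_of_pair {N i : ℕ} {a : ℕ → ℕ}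
    (hmono : ∀ i, i + 1 ≤ N → a i ≤ a (i + 1))
    (hstrict : ∀ i, i + 2 ≤ N → a i < a (i + 2)) (hi : i + 1 ≤ N) (he : a i = a (i + 1)) :
    ((Finset.range (N + 1)).filter fun j => a j = a i).card = 2 := by
  have hm := monotone_upto hmono
  rw [Finset.card_eq_two]
  refine ⟨i, i + 1, by omega, ?_⟩
  ext j
  simp only [Finset.mem_filter, Finset.mem_range, Finset.mem_insert, Finset.mem_singleton]
  constructor
  · rintro ⟨hj, hji⟩
    by_contra hne
    rcases lt_or_gt_of_ne (show j ≠ i by omega) with hlt | hgt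
    · have h1 := hm j (i - 1) (by omega) (by omega)
      have h2 := hstrict (i - 1) (by omega)
      rw [show i - 1 + 2 = i + 1 by omega] at h2
      omega
    · have h1 := hm (i + 2) j (by omega) (by omega)
      have h2 := hstrict i (by omega)
      omega
  · rintro (rfl | rfl)
    · exact ⟨by omega, rfl⟩
    · exact ⟨by omega, he.symm⟩

/-- After a position `c` not paired with its predecessor, non-isolated positions pair up
successively. -/
theorem pair_of_card_ne_one {N c e : ℕ} {a : ℕ → ℕ}
    (hmono : ∀ i, i + 1 ≤ N → a i ≤ a (i + 1))
    (hstrict : ∀ i, i + 2 ≤ N → a i < a (i + 2)) (he : e ≤ N)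
    (hstart : ∀ k, k + 1 = c → a k ≠ a c)
    (hne : ∀ i, c ≤ i → i < e → ((Finset.range (N + 1)).filter fun j => a j = a i).card ≠ 1) :
    ∀ j, c + 2 * j < e → a (c + 2 * j) = a (c + 2 * j + 1) := by
  intro j
  induction j with
  | zero =>
    intro hj
    rcases eq_succ_or_eq_pred_of_card_ne_one hmono (by omega) (hne c le_rfl (by omega))
      with h | ⟨k, hk, h⟩
    · exact h.2
    · exact absurd h (hstart k hk)
  | succ j ih =>
    intro hj
    have h1 := ih (by omega)
    rcases eq_succ_or_eq_pred_of_card_ne_one hmono (by omega)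
      (hne (c + 2 * (j + 1)) (by omega) hj) with h | ⟨k, hk, h⟩
    · exact h.2
    · obtain rfl : k = c + 2 * j + 1 := by omega
      have h2 := hstrict (c + 2 * j) (by omega)
      rw [show c + 2 * (j + 1) = c + 2 * j + 2 by ring] at h
      omega

/-- The first block in normalised form: isolated positions `2 p < 2 r + 1`, all earlier and
intermediate positions being paired. -/
theorem block_eq_or_swap_s13 {N p r : ℕ} {a b : ℕ → ℕ} (hpr : p ≤ r) (hr : 2 * r + 1 ≤ N)
    (hmono : ∀ i, i + 1 ≤ N → a i ≤ a (i + 1))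
    (hstrict : ∀ i, i + 2 ≤ N → a i < a (i + 2))
    (hpair₁ : ∀ j < p, a (2 * j) = a (2 * j + 1))
    (hpair₂ : ∀ j, p ≤ j → j < r → a (2 * j + 1) = a (2 * j + 2))
    (hp : ((Finset.range (N + 1)).filter fun j => a j = a (2 * p)).card = 1)
    (hbstrict : ∀ i, i + 2 ≤ N → b i < b (i + 2))
    (hbmult : (Multiset.range (N + 1)).map b = (Multiset.range (N + 1)).map a)
    (hbcirc : (Multiset.range (N + 1)).map (fun i => b i + i / 2)
        = (Multiset.range (N + 1)).map (fun i => a i + i / 2)) :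
    (∀ j, p ≤ j → j ≤ r → b (2 * j) = a (2 * j) ∧ b (2 * j + 1) = a (2 * j + 1)) ∨
      (∀ j, p ≤ j → j ≤ r → b (2 * j) = a (2 * j + 1) ∧ b (2 * j + 1) = a (2 * j)) := by
  have hm := monotone_upto hmono
  have hcount : ∀ v, ((Finset.range (N + 1)).filter fun i => b i = v).card =
      ((Finset.range (N + 1)).filter fun i => a i = v).card :=
    fun v => card_filter_range_eq_of_map_eq hbmult (· = v)
  have hmem : ∀ i ≤ N, ∃ k ≤ N, a k = b i := by
    intro i hi
    have : b i ∈ (Multiset.range (N + 1)).map b :=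
      Multiset.mem_map_of_mem b (Multiset.mem_range.mpr (by omega))
    rw [hbmult, Multiset.mem_map] at this
    obtain ⟨k, hk, h⟩ := this
    exact ⟨k, by have := Multiset.mem_range.mp hk; omega, h⟩
  -- the distinct values of `a` up to position `2 r + 1`
  obtain ⟨v, hv₁, hv₂⟩ : ∃ v : ℕ → ℕ, (∀ j ≤ p, v j = a (2 * j)) ∧
      ∀ j, p ≤ j → v (j + 1) = a (2 * j + 1) :=
    ⟨fun j => if j ≤ p then a (2 * j) else a (2 * j - 1),
      fun j hj => by simp [hj],
      fun j hj => by
        simp only [show ¬ j + 1 ≤ p by omega, if_false]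
        congr 1⟩
  have hv_even : ∀ j ≤ r, v j = a (2 * j) := by
    intro j hj
    by_cases h : j ≤ p
    · exact hv₁ j h
    · obtain ⟨k, rfl⟩ : ∃ k, j = k + 1 := ⟨j - 1, by omega⟩
      rw [hv₂ k (by omega), hpair₂ k (by omega) (by omega)]
      rfl
  have hsingle : a (2 * p) < a (2 * p + 1) :=
    lt_of_le_of_ne (hmono _ (by omega))
      (ne_of_card_eq_one hp (by omega) (by omega) (by omega)).symm
  have hlt : ∀ j, p ≤ j → j ≤ r → a (2 * j) < a (2 * j + 1) := by
    intro j hj hjr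
    rcases hj.eq_or_lt with rfl | h
    · exact hsingle
    · have h1 := hpair₂ (j - 1) (by omega) (by omega)
      have h2 := hstrict (2 * (j - 1) + 1) (by omega)
      rw [show 2 * (j - 1) + 2 = 2 * j by omega] at h1
      rw [show 2 * (j - 1) + 1 + 2 = 2 * j + 1 by omega] at h2
      omega
  have hv : ∀ j ≤ r, v j < v (j + 1) := by
    intro j hj
    rw [hv_even j hj]
    by_cases h : p ≤ j
    · rw [hv₂ j h]
      exact hlt j h hj
    · rw [hv₁ (j + 1) (by omega)]
      exact hstrict (2 * j) (by omega)
  have hgap : ∀ i ≤ N, ∀ j ≤ r, v j < b i → v (j + 1) ≤ b i := by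
    intro i hi j hj hlt
    obtain ⟨k, hk, hki⟩ := hmem i hi
    rw [hv_even j hj] at hlt
    rw [← hki] at hlt ⊢
    have hk1 : 2 * j < k := by
      by_contra hc
      have := hm k (2 * j) (by omega) (by omega)
      omega
    by_cases h : p ≤ j
    · rw [hv₂ j h]
      exact hm _ _ (by omega) hk
    · rw [hv₁ (j + 1) (by omega)]
      have hk2 : k ≠ 2 * j + 1 := by
        rintro rfl
        have := hpair₁ j (by omega)
        omega
      exact hm _ _ (by omega) hk
  have h0 : ∀ i ≤ N, v 0 ≤ b i := by
    intro i hi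
    obtain ⟨k, hk, hki⟩ := hmem i hi
    rw [hv_even 0 (by omega), ← hki]
    exact hm _ _ (by omega) hk
  have hlate : ∀ i ≤ N, 2 * r + 2 ≤ i → a (2 * r + 1) ≤ b i := by
    intro i hi hri
    rw [← hv₂ r hpr]
    have h1 := le_of_two_step_strict hbstrict hgap h0 (ε := i % 2) (r + 1) le_rfl (by omega)
    have h2 := add_le_of_two_step_strict hbstrict (2 * (r + 1) + i % 2) (i / 2 - (r + 1))
      (by omega)
    rw [show 2 * (r + 1) + i % 2 + 2 * (i / 2 - (r + 1)) = i by omega] at h2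
    omega
  have hbound := le_of_circ_eq hr hmono hlate hbcirc
  have htop : ∀ ε ≤ 1, b (2 * r + ε) ≤ v (r + 1) := by
    intro ε hε
    rw [hv₂ r hpr]
    have := hbound (2 * r + ε) (by omega)
    omega
  have hocc : ∀ ε ≤ 1, ∀ j ≤ r, j ≠ p → ∃ k, 2 * k + ε ≤ N ∧ b (2 * k + ε) = v j := by
    intro ε hε j hj hjp
    refine exists_of_card_eq_two hbstrict ?_ hε
    rw [hcount]
    by_cases h : j < p
    · rw [hv₁ j h.le]
      exact card_eq_two_of_pair hmono hstrict (by omega) (hpair₁ j h)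
    · obtain ⟨k, rfl⟩ : ∃ k, j = k + 1 := ⟨j - 1, by omega⟩
      rw [hv₂ k (by omega)]
      exact card_eq_two_of_pair hmono hstrict (by omega) (hpair₂ k (by omega) (by omega))
  have hE := eq_or_eq_succ_of_ge (ε := 0) hr hbstrict hv hgap h0 (by omega)
    (htop 0 (by omega)) (hocc 0 (by omega))
  have hO := eq_or_eq_succ_of_ge (ε := 1) hr hbstrict hv hgap h0 le_rfl
    (htop 1 le_rfl) (hocc 1 le_rfl)
  have hp' : ((Finset.range (N + 1)).filter fun i => b i = v p).card = 1 := by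
    rw [hcount, hv_even p hpr, hp]
  rcases hE.2 with hE' | hE' <;> rcases hO.2 with hO' | hO'
  · exfalso
    have h1 := hE' p le_rfl hpr
    rw [← h1] at hp'
    refine ne_of_card_eq_one hp' (j := 2 * p + 1) (by omega) (by omega) (by omega) ?_
    rw [hO' p le_rfl hpr, h1]
  · left
    intro j hj hjr
    rw [← hv_even j hjr, ← hv₂ j hj]
    exact ⟨hE' j hj hjr, hO' j hj hjr⟩
  · right
    intro j hj hjr
    rw [← hv_even j hjr, ← hv₂ j hj]
    exact ⟨hE' j hj hjr, hO' j hj hjr⟩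
  · exfalso
    obtain ⟨i, hi⟩ := Finset.card_eq_one.mp hp'
    have hi' : i ∈ (Finset.range (N + 1)).filter fun i => b i = v p := by simp [hi]
    simp only [Finset.mem_filter, Finset.mem_range] at hi'
    have hvm : ∀ i k, i ≤ k → k ≤ r + 1 → v i ≤ v k :=
      monotone_upto fun i hi => (hv i (by omega)).le
    have hvp := hv p hpr
    have hEO : ∀ j < p, b (2 * j + i % 2) = v j := by
      intro j hj
      rcases Nat.mod_two_eq_zero_or_one i with h | h <;> rw [h]
      · exact hE.1 j hj (by omega)
      · exact hO.1 j hj (by omega)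
    have hEO' : b (2 * p + i % 2) = v (p + 1) := by
      rcases Nat.mod_two_eq_zero_or_one i with h | h <;> rw [h]
      · exact hE' p le_rfl hpr
      · exact hO' p le_rfl hpr
    by_cases h : i / 2 < p
    · have h1 := hEO (i / 2) h
      rw [show 2 * (i / 2) + i % 2 = i by omega] at h1
      have h2 := hv (i / 2) (by omega)
      have h3 := hvm (i / 2 + 1) p (by omega) (by omega)
      omega
    · have h2 := add_le_of_two_step_strict hbstrict (2 * p + i % 2) (i / 2 - p) (by omega)
      rw [show 2 * p + i % 2 + 2 * (i / 2 - p) = i by omega] at h2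
      omega

/-- Setup §2: assume `μ ≥ 1` and let `b ∈ ℰ` satisfy `[b°] = [a°]`
as multisets.  Then exactly one of the following holds on the block of indices
`[i_0, i_1]`: either `b_i = a_i` for all `i ∈ [i_0, i_1]`, or
`b_{i_0+2k} = a_{i_0+2k+1}` and `b_{i_0+2k+1} = a_{i_0+2k}` for all
`0 ≤ k ≤ m_0`. -/
theorem stmt_13 (N μ : ℕ) (a I m : ℕ → ℕ)
    (hμ : μ % 2 = N % 2)
    (hμ1 : 1 ≤ μ)
    (hmono : ∀ i, i + 1 ≤ N → a i ≤ a (i + 1))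
    (hstrict : ∀ i, i + 2 ≤ N → a i < a (i + 2))
    (hImono : ∀ s t, s < t → t ≤ μ → I s < I t)
    (hIJ : ∀ i, (i ≤ N ∧ ((Finset.range (N + 1)).filter fun j => a j = a i).card = 1)
        ↔ ∃ s, s ≤ μ ∧ I s = i)
    (hm : ∀ s, s < μ → I (s + 1) = I s + 2 * m s + 1)
    -- `b ∈ ℰ`:
    (b : ℕ → ℕ)
    (hbstrict : ∀ i, i + 2 ≤ N → b i < b (i + 2))
    (hbmult : (Multiset.range (N + 1)).map b = (Multiset.range (N + 1)).map a)
    -- `[b°] = [a°]`: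
    (hbcirc : (Multiset.range (N + 1)).map (fun i => b i + i / 2)
        = (Multiset.range (N + 1)).map (fun i => a i + i / 2)) :
    Xor'
      (∀ i, I 0 ≤ i → i ≤ I 1 → b i = a i)
      (∀ k ≤ m 0, b (I 0 + 2 * k) = a (I 0 + 2 * k + 1)
          ∧ b (I 0 + 2 * k + 1) = a (I 0 + 2 * k)) := by
  have hJ : ∀ s ≤ μ, I s ≤ N ∧
      ((Finset.range (N + 1)).filter fun j => a j = a (I s)).card = 1 :=
    fun s hs => (hIJ (I s)).mpr ⟨s, hs, rfl⟩
  obtain ⟨h0N, h0⟩ := hJ 0 (by omega)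
  obtain ⟨h1N, -⟩ := hJ 1 hμ1
  have hm0 := hm 0 hμ1
  rw [zero_add] at hm0
  have hImono' : ∀ s t, s ≤ t → t ≤ μ → I s ≤ I t := by
    intro s t hst ht
    rcases hst.eq_or_lt with rfl | h
    · rfl
    · exact (hImono s t h ht).le
  have hbefore : ∀ i, 0 ≤ i → i < I 0 →
      ((Finset.range (N + 1)).filter fun j => a j = a i).card ≠ 1 := by
    intro i _ hi hc
    obtain ⟨s, hs, rfl⟩ := (hIJ i).mp ⟨by omega, hc⟩
    have := hImono' 0 s (by omega) hs
    omega
  have hbetween : ∀ i, I 0 + 1 ≤ i → i < I 1 →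
      ((Finset.range (N + 1)).filter fun j => a j = a i).card ≠ 1 := by
    intro i hi hi' hc
    obtain ⟨s, hs, rfl⟩ := (hIJ i).mp ⟨by omega, hc⟩
    rcases Nat.eq_zero_or_pos s with rfl | hpos
    · omega
    · have := hImono' 1 s hpos hs
      omega
  have hpair₁ := pair_of_card_ne_one (c := 0) hmono hstrict h0N (by omega) hbefore
  simp only [zero_add] at hpair₁
  have hpair₂ := pair_of_card_ne_one hmono hstrict h1N
    (fun k hk => by
      obtain rfl : k = I 0 := by omega
      exact (ne_of_card_eq_one h0 h0N (by omega) (by omega)).symm) hbetween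
  obtain ⟨p, hp⟩ : ∃ p, I 0 = 2 * p := by
    refine ⟨I 0 / 2, ?_⟩
    by_contra hodd
    have := hpair₁ (I 0 / 2) (by omega)
    rw [show 2 * (I 0 / 2) + 1 = I 0 by omega] at this
    exact ne_of_card_eq_one h0 h0N (by omega) (by omega) this
  have hq : I 1 = 2 * (p + m 0) + 1 := by omega
  rw [hp] at h0 hpair₁ hpair₂
  rw [hq] at hpair₂
  have hne : a (2 * p + 1) ≠ a (2 * p) :=
    ne_of_card_eq_one h0 (by omega) (by omega) (by omega)
  rw [hp, hq]
  have hmain := block_eq_or_swap_s13 (p := p) (r := p + m 0) (by omega) (by omega) hmono hstrict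
    (fun j hj => hpair₁ j (by omega))
    (fun j hj hjr => by
      have := hpair₂ (j - p) (by omega)
      rwa [show 2 * p + 1 + 2 * (j - p) = 2 * j + 1 by omega] at this)
    h0 hbstrict hbmult hbcirc
  rcases hmain with h | h
  · refine Or.inl ⟨?_, fun hs => ?_⟩
    · intro i hi hi'
      have := h (i / 2) (by omega) (by omega)
      rcases Nat.mod_two_eq_zero_or_one i with hi2 | hi2
      · rw [show i = 2 * (i / 2) by omega]
        exact this.1
      · rw [show i = 2 * (i / 2) + 1 by omega]
        exact this.2
    · exact hne ((hs 0 (by omega)).1.symm.trans (h p le_rfl (by omega)).1)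
  · refine Or.inr ⟨?_, fun hs => ?_⟩
    · intro k hk
      have := h (p + k) (by omega) (by omega)
      rwa [mul_add] at this
    · exact hne ((h p le_rfl (by omega)).1.symm.trans (hs (2 * p) le_rfl (by omega)))
end

section
/- In Setup (§2): the map X ↦ a^X from subsets X ⊆ {0,2,4,…} ∩ [0,μ−1] to ℕ^{N+1} is injective, and {b ∈ ℰ : [b°] = [a°]} = {a^X : X ⊆ {0,2,4,…} ∩ [0,μ−1]}; consequently the set {b ∈ ℰ : [b°] = [a°]} has exactly 2^{⌈μ/2⌉} elements. -/
/-- `f` and `g` agree on every block `{2k, 2k+1}` of `{0, …, n-1}` up to swapping its entries. -/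
def BlockEq (n : ℕ) (f g : ℕ → ℕ) : Prop :=
  ∀ k, (2 * k + 1 < n → f (2 * k) = g (2 * k) ∧ f (2 * k + 1) = g (2 * k + 1) ∨
      f (2 * k) = g (2 * k + 1) ∧ f (2 * k + 1) = g (2 * k)) ∧
    (2 * k + 1 = n → f (2 * k) = g (2 * k))

theorem BlockEq.map_range_eq {n : ℕ} {f g : ℕ → ℕ} (h : BlockEq n f g) :
    (Multiset.range n).map f = (Multiset.range n).map g := by
  induction n using Nat.strong_induction_on with
  | _ n ih =>
    rcases Nat.even_or_odd' n with ⟨k, rfl | rfl⟩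
    · rcases k with _ | k
      · simp
      · have h1 : BlockEq (2 * k) f g := fun j =>
          ⟨fun hj => (h j).1 (by omega), fun hj => by omega⟩
        have h2 := ih (2 * k) (by omega) h1
        have e : 2 * (k + 1) = 2 * k + 1 + 1 := by ring
        rw [e, Multiset.range_succ, Multiset.range_succ]
        simp only [Multiset.map_cons, h2]
        rcases (h k).1 (by omega) with ⟨ha, hb⟩ | ⟨ha, hb⟩
        · rw [ha, hb]
        · rw [ha, hb, Multiset.cons_swap]
    · have h1 : BlockEq (2 * k) f g := fun j =>
        ⟨fun hj => (h j).1 (by omega), fun hj => by omega⟩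
      have h2 := ih (2 * k) (by omega) h1
      rw [Multiset.range_succ]
      simp only [Multiset.map_cons, h2, (h k).2 rfl]

theorem BlockEq.add_half {n : ℕ} {f g : ℕ → ℕ} (h : BlockEq n f g) :
    BlockEq n (fun i => f i + i / 2) (fun i => g i + i / 2) := by
  intro k
  have e1 : 2 * k / 2 = k := by omega
  have e2 : (2 * k + 1) / 2 = k := by omega
  simp only [e1, e2]
  have := h k
  omega

theorem eq_of_map_range_eq_of_le {n : ℕ} {f g : ℕ → ℕ}
    (hf : ∀ i j, i < j → j < n → f i ≤ f j) (hg : ∀ i j, i < j → j < n → g i ≤ g j)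
    (h : (Multiset.range n).map f = (Multiset.range n).map g) : ∀ i < n, f i = g i := by
  have hs : ∀ f : ℕ → ℕ, (∀ i j, i < j → j < n → f i ≤ f j) →
      ((List.range n).map f).Pairwise (· ≤ ·) := by
    intro f hf
    rw [List.pairwise_map]
    exact List.pairwise_lt_range.imp_of_mem fun {i j} _ hj hij => hf i j hij (by simpa using hj)
  have hp : ((List.range n).map f).Perm ((List.range n).map g) := by
    rw [← Multiset.coe_eq_coe]
    exact h
  have := hp.eq_of_pairwise' (hs f hf) (hs g hg)
  intro i hi
  exact List.map_inj_left.1 this i (by simpa using hi)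

/-- The sequence obtained by sorting each block `{2k, 2k+1}` of `{0, …, n-1}`. -/
def blockSort (n : ℕ) (b : ℕ → ℕ) (i : ℕ) : ℕ :=
  if i % 2 = 0 then (if i + 1 < n then min (b i) (b (i + 1)) else b i)
  else max (b (i - 1)) (b i)

theorem blockEq_blockSort (n : ℕ) (b : ℕ → ℕ) : BlockEq n b (blockSort n b) := by
  intro k
  have e1 : 2 * k % 2 = 0 := by omega
  have e2 : (2 * k + 1) % 2 = 1 := by omega
  have e3 : 2 * k + 1 - 1 = 2 * k := by omega
  simp only [blockSort, e1, e2, e3, if_true, if_false, one_ne_zero]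
  constructor
  · intro h
    rw [if_pos h]
    omega
  · intro h
    rw [if_neg (by omega)]

theorem blockEq_of_map_eq_of_blockMono {n : ℕ} {a b : ℕ → ℕ}
    (ha : ∀ i j, i < j → j < n → a i ≤ a j)
    (hb : ∀ i j, i < n → j < n → i / 2 < j / 2 → b i ≤ b j)
    (h : (Multiset.range n).map b = (Multiset.range n).map a) : BlockEq n b a := by
  have hB := blockEq_blockSort n b
  have hmono : ∀ i j, i < j → j < n → blockSort n b i ≤ blockSort n b j := by
    intro i j hij hj
    by_cases hd : i / 2 = j / 2
    · obtain rfl : j = i + 1 := by omega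
      have e1 : i % 2 = 0 := by omega
      have e2 : (i + 1) % 2 ≠ 0 := by omega
      simp only [blockSort, e1, e2, if_true, if_false, Nat.add_sub_cancel]
      rw [if_pos hj]
      omega
    · have key : ∀ i < n, ∃ i' < n, i' / 2 = i / 2 ∧ blockSort n b i = b i' := by
        intro i hi
        unfold blockSort
        split_ifs with h1 h2
        · rcases min_choice (b i) (b (i + 1)) with h | h
          · exact ⟨i, hi, rfl, h⟩
          · exact ⟨i + 1, h2, by omega, h⟩
        · exact ⟨i, hi, rfl, rfl⟩
        · rcases max_choice (b (i - 1)) (b i) with h | h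
          · exact ⟨i - 1, by omega, by omega, h⟩
          · exact ⟨i, hi, rfl, h⟩
      obtain ⟨i', hi', hi2, ei⟩ := key i (by omega)
      obtain ⟨j', hj', hj2, ej⟩ := key j hj
      rw [ei, ej]
      exact hb _ _ hi' hj' (by omega)
  have heq := eq_of_map_range_eq_of_le hmono ha (hB.map_range_eq.symm.trans h)
  intro k
  have h1 := hB k
  have h2 := heq (2 * k)
  have h3 := heq (2 * k + 1)
  constructor
  · intro hk
    rw [← h2 (by omega), ← h3 hk]
    exact h1.1 hk
  · intro hk
    rw [← h2 (by omega)]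
    exact h1.2 hk

theorem map_univ_fin_val (n : ℕ) (f : ℕ → ℕ) :
    (Finset.univ : Finset (Fin n)).val.map (fun i : Fin n => f i) = (Multiset.range n).map f := by
  rw [Fin.univ_val_map, List.ofFn_eq_map, ← Multiset.coe_range, Multiset.map_coe,
    ← List.map_coe_finRange_eq_range, List.map_map]
  rfl

theorem blockMono_of_map_add_half_eq {n : ℕ} {a b : ℕ → ℕ}
    (ha : ∀ i j, i < j → j < n → a i ≤ a j)
    (h : (Multiset.range n).map b = (Multiset.range n).map a)
    (h' : (Multiset.range n).map (fun i => b i + i / 2) =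
      (Multiset.range n).map (fun i => a i + i / 2)) :
    ∀ i j, i < n → j < n → i / 2 < j / 2 → b i ≤ b j := by
  have hsum : ∀ f g : ℕ → ℕ, (Multiset.range n).map f = (Multiset.range n).map g →
      ∑ i : Fin n, (f i) ^ 2 = ∑ i : Fin n, (g i) ^ 2 := by
    intro f g hfg
    rw [← map_univ_fin_val, ← map_univ_fin_val] at hfg
    have := congrArg (fun s => (s.map (fun x : ℕ => x ^ 2)).sum) hfg
    rw [Multiset.map_map, Multiset.map_map] at this
    exact this
  have s1 := hsum _ _ h
  have s2 := hsum _ _ h'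
  have s3 : ∑ i : Fin n, ((i : ℕ) / 2) * b i = ∑ i : Fin n, ((i : ℕ) / 2) * a i := by
    have e : ∀ f : ℕ → ℕ, ∑ i : Fin n, (f i + (i : ℕ) / 2) ^ 2 =
        ∑ i : Fin n, (f i) ^ 2 + 2 * ∑ i : Fin n, ((i : ℕ) / 2) * f i +
          ∑ i : Fin n, ((i : ℕ) / 2) ^ 2 := by
      intro f
      rw [Finset.mul_sum, ← Finset.sum_add_distrib, ← Finset.sum_add_distrib]
      exact Finset.sum_congr rfl fun i _ => by ring
    rw [e, e] at s2
    omega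
  obtain ⟨σ, hσ⟩ : ∃ σ : Equiv.Perm (Fin n), ∀ i : Fin n, b i = a (σ i) := by
    let b' : Fin n → ℕ := fun i => b i
    have hs : (List.ofFn (b' ∘ Tuple.sort b')).Pairwise (· ≤ ·) :=
      List.pairwise_ofFn.2 fun i j hij => Tuple.monotone_sort b' hij.le
    have hs' : (List.ofFn (fun i : Fin n => a i)).Pairwise (· ≤ ·) :=
      List.pairwise_ofFn.2 fun i j hij => ha i j hij j.2
    have hp : (List.ofFn b').Perm (List.ofFn (fun i : Fin n => a i)) := by
      rw [← Multiset.coe_eq_coe, ← Fin.univ_val_map, ← Fin.univ_val_map,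
        map_univ_fin_val, map_univ_fin_val, h]
    have := ((Equiv.Perm.ofFn_comp_perm (Tuple.sort b') b').trans hp).eq_of_pairwise' hs hs'
    refine ⟨(Tuple.sort b')⁻¹, fun i => ?_⟩
    rw [← congrFun (List.ofFn_injective this) ((Tuple.sort b')⁻¹ i)]
    simp [b']
  have hmv : Monovary (fun i : Fin n => (i : ℕ) / 2) (fun i : Fin n => a i) := by
    intro i j hij
    by_contra hc
    have := ha j i (by simp only at hc; omega) i.2
    simp only at hij
    omega
  simp only [hσ] at s3
  have hm := hmv.sum_mul_comp_perm_eq_sum_mul_iff.1 s3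
  intro i j hi hj hij
  by_contra hc
  have := @hm ⟨j, hj⟩ ⟨i, hi⟩ (by
    simp only [Function.comp_apply, ← hσ]
    omega)
  simp only at this
  omega

/-- The data of the setup: a special symbol `a` of length `N + 1`, whose entries of multiplicity one
sit at the positions `I 0 < … < I μ`, and half-gaps `m s` between consecutive ones. -/
structure SpecialSymbol (N μ : ℕ) (a I m : ℕ → ℕ) : Prop where
  parity : μ % 2 = N % 2
  mono : ∀ i, i + 1 ≤ N → a i ≤ a (i + 1)
  strict : ∀ i, i + 2 ≤ N → a i < a (i + 2)
  index_strictMono : ∀ s t, s < t → t ≤ μ → I s < I t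
  single_iff : ∀ i, (i ≤ N ∧ ((Finset.range (N + 1)).filter fun j => a j = a i).card = 1)
    ↔ ∃ s, s ≤ μ ∧ I s = i
  gap : ∀ s, s < μ → I (s + 1) = I s + 2 * m s + 1

/-- The block `{2k, 2k+1}` lies in one of the intervals `[I s, I (s+1)]` with `s ∈ X`. -/
def InChain (I m : ℕ → ℕ) (X : Finset ℕ) (k : ℕ) : Prop :=
  ∃ s ∈ X, I s ≤ 2 * k ∧ 2 * k ≤ I s + 2 * m s

namespace SpecialSymbol

variable {N μ : ℕ} {a I m : ℕ → ℕ}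

theorem le_of_lt (h : SpecialSymbol N μ a I m) : ∀ i j, i < j → j < N + 1 → a i ≤ a j := by
  intro i j hij hj
  induction j, hij using Nat.le_induction with
  | base => exact h.mono i (by omega)
  | succ j hj' ih => exact (ih (by omega)).trans (h.mono j (by omega))

theorem index_le (h : SpecialSymbol N μ a I m) {s : ℕ} (hs : s ≤ μ) : I s ≤ N :=
  ((h.single_iff (I s)).2 ⟨s, hs, rfl⟩).1

theorem eq_of_index (h : SpecialSymbol N μ a I m) {s j : ℕ} (hs : s ≤ μ) (hj : j ≤ N)
    (e : a j = a (I s)) : j = I s := by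
  obtain ⟨hN, hc⟩ := (h.single_iff (I s)).2 ⟨s, hs, rfl⟩
  rw [Finset.card_eq_one] at hc
  obtain ⟨x, hx⟩ := hc
  have h1 : j ∈ ({x} : Finset ℕ) := by
    rw [← hx]
    exact Finset.mem_filter.2 ⟨Finset.mem_range.2 (by omega), e⟩
  have h2 : I s ∈ ({x} : Finset ℕ) := by
    rw [← hx]
    exact Finset.mem_filter.2 ⟨Finset.mem_range.2 (by omega), rfl⟩
  rw [Finset.mem_singleton] at h1 h2
  rw [h1, h2]

theorem lt_index_succ (h : SpecialSymbol N μ a I m) {s : ℕ} (hs : s ≤ μ) (hN : I s + 1 ≤ N) :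
    a (I s) < a (I s + 1) := by
  have h1 := h.mono (I s) hN
  have h2 := h.eq_of_index hs hN
  by_contra hc
  have := h2 (by omega)
  omega

theorem pred_lt_index (h : SpecialSymbol N μ a I m) {s j : ℕ} (hs : s ≤ μ) (hj : j + 1 = I s) :
    a j < a (j + 1) := by
  have h0 := h.index_le hs
  have h1 := h.mono j (by omega)
  have h2 := h.eq_of_index (j := j) hs (by omega)
  by_contra hc
  rw [← hj] at h2
  have := h2 (by omega)
  omega

/-- A position which is not isolated and does not repeat its predecessor repeats in its successor. -/
theorem eq_succ_of_not_index (h : SpecialSymbol N μ a I m) {p : ℕ} (hp : p ≤ N)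
    (hlt : ∀ j, j + 1 = p → a j < a p) (hI : ∀ s ≤ μ, I s ≠ p) :
    p + 1 ≤ N ∧ a p = a (p + 1) := by
  by_contra hc
  have : ∃ s, s ≤ μ ∧ I s = p := by
    rw [← h.single_iff]
    refine ⟨hp, Finset.card_eq_one.2 ⟨p, ?_⟩⟩
    ext j
    simp only [Finset.mem_filter, Finset.mem_range, Finset.mem_singleton]
    refine ⟨fun ⟨hj, e⟩ => ?_, fun e => by subst e; exact ⟨by omega, rfl⟩⟩
    rcases lt_trichotomy j p with hjp | hjp | hjp
    · have h1 := hlt (p - 1) (by omega)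
      rcases Nat.lt_or_ge j (p - 1) with h2 | h2
      · have := h.le_of_lt j (p - 1) h2 (by omega)
        omega
      · obtain rfl : j = p - 1 := by omega
        omega
    · exact hjp
    · have h1 := h.mono p (by omega)
      rcases Nat.lt_or_ge (p + 1) j with h2 | h2
      · have := h.le_of_lt (p + 1) j h2 hj
        omega
      · obtain rfl : j = p + 1 := by omega
        omega
  obtain ⟨s, hs, e⟩ := this
  exact hI s hs e

/-- A stretch `[p, q)` without isolated positions is a union of pairs of equal entries. -/
theorem pairs_of_no_index (h : SpecialSymbol N μ a I m) {p q : ℕ} (hq : q ≤ N + 1)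
    (hlt : ∀ j, j + 1 = p → p ≤ N → a j < a p) (hI : ∀ s ≤ μ, ¬ (p ≤ I s ∧ I s < q)) (t : ℕ)
    (ht : p + 2 * t < q) : p + 2 * t + 1 ≤ N ∧ a (p + 2 * t) = a (p + 2 * t + 1) := by
  induction t with
  | zero =>
    exact h.eq_succ_of_not_index (by omega) (fun j hj => hlt j hj (by omega))
      fun s hs e => hI s hs (by omega)
  | succ t ih =>
    have ih := ih (by omega)
    refine h.eq_succ_of_not_index (by omega) (fun j hj => ?_)
      fun s hs e => hI s hs (by omega)
    obtain rfl : j = p + 2 * t + 1 := by omega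
    rw [← ih.2]
    exact h.strict (p + 2 * t) (by omega)

theorem index_zero_even (h : SpecialSymbol N μ a I m) : I 0 % 2 = 0 := by
  by_contra hc
  have h0 := h.index_le (Nat.zero_le μ)
  have := h.pairs_of_no_index (p := 0) (q := I 0) (by omega) (by omega) (fun s hs hc => by
    rcases Nat.eq_zero_or_pos s with rfl | hs0
    · omega
    · have := h.index_strictMono 0 s hs0 hs
      omega) (I 0 / 2) (by omega)
  have e : 0 + 2 * (I 0 / 2) + 1 = I 0 := by omega
  rw [e] at this
  have := h.eq_of_index (Nat.zero_le μ) (by omega) this.2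
  omega

theorem index_mod_two (h : SpecialSymbol N μ a I m) {s : ℕ} (hs : s ≤ μ) : I s % 2 = s % 2 := by
  induction s with
  | zero => exact h.index_zero_even
  | succ s ih =>
    have := ih (by omega)
    have := h.gap s (by omega)
    omega

theorem not_index_between (h : SpecialSymbol N μ a I m) {s : ℕ} (hs : s < μ) :
    ∀ t ≤ μ, ¬ (I s + 1 ≤ I t ∧ I t < I (s + 1)) := by
  intro t ht hc
  rcases lt_trichotomy t s with h1 | rfl | h1
  · have := h.index_strictMono t s h1 (by omega)
    omega
  · omega
  · rcases Nat.lt_or_ge (s + 1) t with h2 | h2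
    · have := h.index_strictMono (s + 1) t h2 ht
      omega
    · obtain rfl : t = s + 1 := by omega
      omega

theorem eq_of_between (h : SpecialSymbol N μ a I m) {s k : ℕ} (hs : s < μ) (hk : k < m s) :
    a (I s + 2 * k + 1) = a (I s + 2 * k + 2) := by
  have hg := h.gap s hs
  have h1 := h.index_le (s := s + 1) (by omega)
  have := h.pairs_of_no_index (p := I s + 1) (q := I (s + 1)) (by omega)
    (fun j hj hN => by
      obtain rfl : j = I s := by omega
      exact h.lt_index_succ hs.le hN) (h.not_index_between hs) k (by omega)
  have e : I s + 1 + 2 * k = I s + 2 * k + 1 := by omega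
  rw [e] at this
  exact this.2

theorem eq_of_tail (h : SpecialSymbol N μ a I m) {k : ℕ} (hk : I μ + 2 * k + 1 ≤ N) :
    I μ + 2 * k + 2 ≤ N ∧ a (I μ + 2 * k + 1) = a (I μ + 2 * k + 2) := by
  have := h.pairs_of_no_index (p := I μ + 1) (q := N + 1) le_rfl
    (fun j hj hN => by
      obtain rfl : j = I μ := by omega
      exact h.lt_index_succ le_rfl hN)
    (fun s hs hc => by
      rcases Nat.lt_or_ge s μ with h1 | h1
      · have := h.index_strictMono s μ h1 le_rfl
        omega
      · obtain rfl : s = μ := by omega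
        omega) k (by omega)
  have e : I μ + 1 + 2 * k = I μ + 2 * k + 1 := by omega
  rw [e] at this
  exact this

/-- Every block has equal entries, or lies in an interval `[I s, I (s+1)]` with `s` even,
or lies to the right of the last isolated position. -/
theorem block_cases (h : SpecialSymbol N μ a I m) {k : ℕ} (hk : 2 * k ≤ N) :
    (2 * k + 1 ≤ N ∧ a (2 * k) = a (2 * k + 1)) ∨
      (∃ s, s < μ ∧ s % 2 = 0 ∧ I s ≤ 2 * k ∧ 2 * k ≤ I s + 2 * m s) ∨
      (μ % 2 = 0 ∧ I μ ≤ 2 * k) := by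
  rcases Nat.lt_or_ge (2 * k) (I 0) with h0 | h0
  · left
    have hI0 := h.index_le (Nat.zero_le μ)
    have := h.pairs_of_no_index (p := 0) (q := I 0) (by omega) (by omega) (fun s hs hc => by
      rcases Nat.eq_zero_or_pos s with rfl | hs0
      · omega
      · have := h.index_strictMono 0 s hs0 hs
        omega) k (by omega)
    rwa [Nat.zero_add] at this
  · obtain ⟨s, hs, hsk, hmax⟩ : ∃ s ≤ μ, I s ≤ 2 * k ∧ (s < μ → 2 * k < I (s + 1)) := by
      have hex : ∀ n ≤ μ, (∃ s ≤ μ, I s ≤ 2 * k ∧ (s < μ → 2 * k < I (s + 1))) ∨ I n ≤ 2 * k := by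
        intro n hn
        induction n with
        | zero => exact Or.inr h0
        | succ n ih =>
          rcases ih (by omega) with ih | ih
          · exact Or.inl ih
          · rcases Nat.lt_or_ge (2 * k) (I (n + 1)) with h1 | h1
            · exact Or.inl ⟨n, by omega, ih, fun _ => h1⟩
            · exact Or.inr h1
      rcases hex μ le_rfl with h1 | h1
      · exact h1
      · exact ⟨μ, le_rfl, h1, fun h2 => by omega⟩
    have hpar := h.index_mod_two hs
    rcases Nat.lt_or_ge s μ with hlt | hge
    · have hg := h.gap s hlt
      have hmax := hmax hlt
      rcases Nat.mod_two_eq_zero_or_one s with he | ho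
      · exact Or.inr (Or.inl ⟨s, hlt, he, hsk, by omega⟩)
      · left
        have h1 := h.index_le (s := s + 1) (by omega)
        have := h.eq_of_between hlt (k := (2 * k - I s - 1) / 2) (by omega)
        have e1 : I s + 2 * ((2 * k - I s - 1) / 2) + 1 = 2 * k := by omega
        have e2 : I s + 2 * ((2 * k - I s - 1) / 2) + 2 = 2 * k + 1 := by omega
        rw [e1, e2] at this
        exact ⟨by omega, this⟩
    · obtain rfl : s = μ := by omega
      rcases Nat.mod_two_eq_zero_or_one s with he | ho
      · exact Or.inr (Or.inr ⟨he, hsk⟩)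
      · left
        have e1 : I s + 2 * ((2 * k - I s - 1) / 2) + 1 = 2 * k := by omega
        have e2 : I s + 2 * ((2 * k - I s - 1) / 2) + 2 = 2 * k + 1 := by omega
        have := h.eq_of_tail (k := (2 * k - I s - 1) / 2) (by omega)
        rw [e1, e2] at this
        exact this

theorem le_of_inChain (h : SpecialSymbol N μ a I m) {X : Finset ℕ}
    (hX : X ⊆ (Finset.range μ).filter fun s => s % 2 = 0) {k : ℕ} (hk : InChain I m X k) :
    2 * k + 1 ≤ N := by
  obtain ⟨s, hs, h1, h2⟩ := hk
  have hs := hX hs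
  simp only [Finset.mem_filter, Finset.mem_range] at hs
  have := h.gap s hs.1
  have := h.index_le (s := s + 1) (by omega)
  have := h.index_mod_two hs.1.le
  omega

/-- Intervals `[I s, I (s+1)]` with `s` even are disjoint. -/
theorem mem_of_inChain (h : SpecialSymbol N μ a I m) {X : Finset ℕ}
    (hX : X ⊆ (Finset.range μ).filter fun s => s % 2 = 0) {s k : ℕ} (hs : s < μ)
    (hs2 : s % 2 = 0) (h1 : I s ≤ 2 * k) (h2 : 2 * k ≤ I s + 2 * m s) (hk : InChain I m X k) :
    s ∈ X := by
  obtain ⟨t, ht, h3, h4⟩ := hk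
  have htX := ht
  have ht := hX ht
  simp only [Finset.mem_filter, Finset.mem_range] at ht
  have g1 := h.gap s hs
  have g2 := h.gap t ht.1
  rcases lt_trichotomy s t with hst | rfl | hst
  · have := h.index_strictMono (s + 1) t (by omega) (by omega)
    omega
  · exact htX
  · have := h.index_strictMono (t + 1) s (by omega) (by omega)
    omega

theorem inChain_succ_iff (h : SpecialSymbol N μ a I m) {X : Finset ℕ}
    (hX : X ⊆ (Finset.range μ).filter fun s => s % 2 = 0) {k : ℕ} (hk : 2 * k + 2 ≤ N)
    (e : a (2 * k + 1) = a (2 * k + 2)) : InChain I m X k ↔ InChain I m X (k + 1) := by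
  have key : ∀ s ∈ X, s < μ ∧ I s % 2 = 0 ∧ I (s + 1) ≠ 2 * k + 1 ∧ I s ≠ 2 * k + 2 ∧
      I (s + 1) = I s + 2 * m s + 1 := by
    intro s hs
    have hs := hX hs
    simp only [Finset.mem_filter, Finset.mem_range] at hs
    refine ⟨hs.1, by rw [h.index_mod_two hs.1.le, hs.2], fun h1 => ?_, fun h1 => ?_, h.gap s hs.1⟩
    · have := h.lt_index_succ (s := s + 1) (by omega) (by omega)
      rw [h1] at this
      exact this.ne e
    · have : a (2 * k + 1) < a (2 * k + 2) :=
        h.pred_lt_index (s := s) (j := 2 * k + 1) (by omega) (by omega)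
      omega
  constructor
  · rintro ⟨s, hs, h1, h2⟩
    have := key s hs
    exact ⟨s, hs, by omega, by omega⟩
  · rintro ⟨s, hs, h1, h2⟩
    have := key s hs
    exact ⟨s, hs, by omega, by omega⟩

/-- Two consecutive blocks linked by an equality `a (2k+1) = a (2k+2)` are swapped together. -/
theorem swap_succ_iff (h : SpecialSymbol N μ a I m) {b : ℕ → ℕ}
    (hb : ∀ i, i + 2 ≤ N → b i < b (i + 2)) (hB : BlockEq (N + 1) b a) {k : ℕ}
    (hk : 2 * k + 3 ≤ N) (e : a (2 * k + 1) = a (2 * k + 2)) :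
    b (2 * k) = a (2 * k + 1) ↔ b (2 * k + 2) = a (2 * k + 3) := by
  have h1 := (hB k).1 (by omega)
  have h2 := (hB (k + 1)).1 (by omega)
  have e1 : 2 * (k + 1) = 2 * k + 2 := by ring
  rw [e1] at h2
  have h3 := h.strict (2 * k) (by omega)
  have h4 := h.strict (2 * k + 1) (by omega)
  have h5 := hb (2 * k) (by omega)
  have h6 := hb (2 * k + 1) (by omega)
  simp only [Nat.add_assoc, Nat.reduceAdd] at *
  omega

theorem swap_iff_of_chain (h : SpecialSymbol N μ a I m) {b : ℕ → ℕ}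
    (hb : ∀ i, i + 2 ≤ N → b i < b (i + 2)) (hB : BlockEq (N + 1) b a) {s : ℕ} (hs : s < μ)
    (hs2 : s % 2 = 0) {k : ℕ} (hk : k ≤ m s) :
    b (I s) = a (I s + 1) ↔ b (I s + 2 * k) = a (I s + 2 * k + 1) := by
  have hpar := h.index_mod_two hs.le
  have hg := h.gap s hs
  have hN := h.index_le (s := s + 1) (by omega)
  induction k with
  | zero => rfl
  | succ k ih =>
    refine (ih (by omega)).trans ?_
    have e := h.eq_of_between hs (k := k) (by omega)
    obtain ⟨j, hj⟩ : ∃ j, I s + 2 * k = 2 * j := ⟨I s / 2 + k, by omega⟩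
    have e1 : I s + 2 * (k + 1) = 2 * j + 2 := by omega
    rw [hj] at e
    rw [hj, e1]
    exact h.swap_succ_iff hb hB (by omega) e

theorem eq_of_right_tail (h : SpecialSymbol N μ a I m) {b : ℕ → ℕ}
    (hb : ∀ i, i + 2 ≤ N → b i < b (i + 2)) (hB : BlockEq (N + 1) b a) (hμ : μ % 2 = 0) (d : ℕ) :
    ∀ k, I μ ≤ 2 * k → 2 * k + 2 * d = N →
      b (2 * k) = a (2 * k) ∧ (2 * k + 1 ≤ N → b (2 * k + 1) = a (2 * k + 1)) := by
  have hpar := h.index_mod_two le_rfl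
  induction d with
  | zero => exact fun k _ hk => ⟨(hB k).2 (by omega), fun hc => by omega⟩
  | succ d ih =>
    intro k hk hd
    have h1 := (hB k).1 (by omega)
    have h2 := (ih (k + 1) (by omega) (by omega)).1
    have h3 := h.eq_of_tail (k := k - I μ / 2) (by omega)
    have e1 : I μ + 2 * (k - I μ / 2) = 2 * k := by omega
    have e2 : 2 * (k + 1) = 2 * k + 2 := by ring
    rw [e1] at h3
    rw [e2] at h2
    have h4 := hb (2 * k) (by omega)
    omega

section Swap

variable {X : Finset ℕ} {c : ℕ → ℕ}

theorem swap_of_inChain (h : SpecialSymbol N μ a I m)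
    (hX : X ⊆ (Finset.range μ).filter fun s => s % 2 = 0)
    (hc : ∀ s ∈ X, ∀ k ≤ m s, c (I s + 2 * k) = a (I s + 2 * k + 1) ∧
      c (I s + 2 * k + 1) = a (I s + 2 * k)) {k : ℕ} (hk : InChain I m X k) :
    c (2 * k) = a (2 * k + 1) ∧ c (2 * k + 1) = a (2 * k) := by
  obtain ⟨s, hs, h1, h2⟩ := hk
  have hsX := hX hs
  simp only [Finset.mem_filter, Finset.mem_range] at hsX
  have hpar := h.index_mod_two hsX.1.le
  have := hc s hs (k - I s / 2) (by omega)
  have e : I s + 2 * (k - I s / 2) = 2 * k := by omega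
  rwa [e] at this

theorem eq_of_not_inChain (h : SpecialSymbol N μ a I m)
    (hX : X ⊆ (Finset.range μ).filter fun s => s % 2 = 0)
    (hc' : ∀ i ≤ N, (∀ s ∈ X, ¬ (I s ≤ i ∧ i ≤ I s + 2 * m s + 1)) → c i = a i) {k : ℕ}
    (hk : ¬ InChain I m X k) {i : ℕ} (hi : i ≤ N) (hik : i / 2 = k) : c i = a i := by
  refine hc' i hi fun s hs hsi => hk ⟨s, hs, ?_⟩
  have hsX := hX hs
  simp only [Finset.mem_filter, Finset.mem_range] at hsX
  have hpar := h.index_mod_two hsX.1.le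
  omega

theorem blockEq_swap (h : SpecialSymbol N μ a I m)
    (hX : X ⊆ (Finset.range μ).filter fun s => s % 2 = 0)
    (hc : ∀ s ∈ X, ∀ k ≤ m s, c (I s + 2 * k) = a (I s + 2 * k + 1) ∧
      c (I s + 2 * k + 1) = a (I s + 2 * k))
    (hc' : ∀ i ≤ N, (∀ s ∈ X, ¬ (I s ≤ i ∧ i ≤ I s + 2 * m s + 1)) → c i = a i) :
    BlockEq (N + 1) c a := by
  intro k
  by_cases hk : InChain I m X k
  · have := h.le_of_inChain hX hk
    exact ⟨fun _ => Or.inr (h.swap_of_inChain hX hc hk), fun _ => by omega⟩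
  · exact ⟨fun hN => Or.inl ⟨h.eq_of_not_inChain hX hc' hk (by omega) (by omega),
      h.eq_of_not_inChain hX hc' hk (by omega) (by omega)⟩,
      fun hN => h.eq_of_not_inChain hX hc' hk (by omega) (by omega)⟩

theorem strict_swap (h : SpecialSymbol N μ a I m)
    (hX : X ⊆ (Finset.range μ).filter fun s => s % 2 = 0)
    (hc : ∀ s ∈ X, ∀ k ≤ m s, c (I s + 2 * k) = a (I s + 2 * k + 1) ∧
      c (I s + 2 * k + 1) = a (I s + 2 * k))
    (hc' : ∀ i ≤ N, (∀ s ∈ X, ¬ (I s ≤ i ∧ i ≤ I s + 2 * m s + 1)) → c i = a i) {i : ℕ}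
    (hi : i + 2 ≤ N) : c i < c (i + 2) := by
  have hB := h.blockEq_swap hX hc hc'
  obtain ⟨k, hk⟩ : ∃ k, i = 2 * k ∨ i = 2 * k + 1 := ⟨i / 2, by omega⟩
  have e2 : 2 * (k + 1) = 2 * k + 2 := by ring
  have b1 := (hB k).1 (by omega)
  have b2 := hB (k + 1)
  rw [e2] at b2
  have m1 := h.mono (2 * k) (by omega)
  have m2 : a (2 * k + 1) ≤ a (2 * k + 2) := h.mono (2 * k + 1) (by omega)
  have m3 : 2 * k + 3 ≤ N → a (2 * k + 2) ≤ a (2 * k + 3) := h.mono (2 * k + 2)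
  have s1 := h.strict (2 * k) (by omega)
  have s2 : 2 * k + 3 ≤ N → a (2 * k + 1) < a (2 * k + 3) := h.strict (2 * k + 1)
  simp only [Nat.add_assoc, Nat.reduceAdd] at b2
  have e3 : 2 * k + 1 + 2 = 2 * k + 3 := rfl
  rcases m2.lt_or_eq with hlt | heq
  · rcases hk with rfl | rfl
    · omega
    · rw [e3]
      omega
  · have hiff := h.inChain_succ_iff hX (by omega) heq
    by_cases hk1 : InChain I m X k
    · have hN := h.le_of_inChain hX (hiff.1 hk1)
      have c1 := h.swap_of_inChain hX hc hk1
      have c2 := h.swap_of_inChain hX hc (hiff.1 hk1)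
      rw [e2] at c2
      simp only [Nat.add_assoc, Nat.reduceAdd] at c2
      rcases hk with rfl | rfl
      · omega
      · rw [e3]
        omega
    · rw [h.eq_of_not_inChain hX hc' hk1 (i := i) (by omega) (by omega),
        h.eq_of_not_inChain hX hc' (mt hiff.2 hk1) (i := i + 2) (by omega) (by omega)]
      exact h.strict i hi

/-- A block-swapped strictly increasing `b` is recovered from the chains that it swaps. -/
theorem eq_swap (h : SpecialSymbol N μ a I m)
    (hX : X ⊆ (Finset.range μ).filter fun s => s % 2 = 0)
    (hc : ∀ s ∈ X, ∀ k ≤ m s, c (I s + 2 * k) = a (I s + 2 * k + 1) ∧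
      c (I s + 2 * k + 1) = a (I s + 2 * k))
    (hc' : ∀ i ≤ N, (∀ s ∈ X, ¬ (I s ≤ i ∧ i ≤ I s + 2 * m s + 1)) → c i = a i) {b : ℕ → ℕ}
    (hb : ∀ i, i + 2 ≤ N → b i < b (i + 2)) (hB : BlockEq (N + 1) b a)
    (hbX : ∀ s < μ, s % 2 = 0 → (s ∈ X ↔ b (I s) = a (I s + 1))) {i : ℕ} (hi : i ≤ N) :
    b i = c i := by
  obtain ⟨k, hk⟩ : ∃ k, i = 2 * k ∨ i = 2 * k + 1 := ⟨i / 2, by omega⟩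
  have bb := hB k
  have bc := h.blockEq_swap hX hc hc' k
  rcases h.block_cases (k := k) (by omega) with ⟨hN, e⟩ | ⟨s, hs, hs2, h1, h2⟩ | ⟨hμ, h1⟩
  · rcases hk with rfl | rfl <;> omega
  · have hpar := h.index_mod_two hs.le
    have hg := h.gap s hs
    have hN := h.index_le (s := s + 1) (by omega)
    have hiff := h.swap_iff_of_chain hb hB hs hs2 (k := k - I s / 2) (by omega)
    have e : I s + 2 * (k - I s / 2) = 2 * k := by omega
    rw [e, ← hbX s hs hs2] at hiff
    by_cases hsX : s ∈ X
    · have c1 := h.swap_of_inChain hX hc ⟨s, hsX, h1, h2⟩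
      have := hiff.1 hsX
      rcases hk with rfl | rfl <;> omega
    · have hnc : ¬ InChain I m X k := fun hc => hsX (h.mem_of_inChain hX hs hs2 h1 h2 hc)
      rw [h.eq_of_not_inChain hX hc' hnc hi (by omega)]
      have := mt hiff.2 hsX
      rcases hk with rfl | rfl <;> omega
  · have hnc : ¬ InChain I m X k := by
      rintro ⟨s, hs, h3, h4⟩
      have hs := hX hs
      simp only [Finset.mem_filter, Finset.mem_range] at hs
      have hg := h.gap s hs.1
      rcases Nat.lt_or_ge (s + 1) μ with h5 | h5
      · have := h.index_strictMono (s + 1) μ h5 le_rfl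
        omega
      · obtain rfl : μ = s + 1 := by omega
        omega
    rw [h.eq_of_not_inChain hX hc' hnc hi (by omega)]
    have hp := h.parity
    have := h.eq_of_right_tail hb hB hμ (N / 2 - k) k h1 (by omega)
    rcases hk with rfl | rfl
    · exact this.1
    · exact this.2 hi

theorem mem_iff_swap (h : SpecialSymbol N μ a I m)
    (hX : X ⊆ (Finset.range μ).filter fun s => s % 2 = 0)
    (hc : ∀ s ∈ X, ∀ k ≤ m s, c (I s + 2 * k) = a (I s + 2 * k + 1) ∧
      c (I s + 2 * k + 1) = a (I s + 2 * k))
    (hc' : ∀ i ≤ N, (∀ s ∈ X, ¬ (I s ≤ i ∧ i ≤ I s + 2 * m s + 1)) → c i = a i) {s : ℕ}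
    (hs : s < μ) (hs2 : s % 2 = 0) : s ∈ X ↔ c (I s) = a (I s + 1) := by
  refine ⟨fun hsX => (hc s hsX 0 (Nat.zero_le _)).1, fun e => ?_⟩
  by_contra hsX
  have hpar := h.index_mod_two hs.le
  have hg := h.gap s hs
  have hN := h.index_le (s := s + 1) (by omega)
  have hnc : ¬ InChain I m X (I s / 2) :=
    fun hc => hsX (h.mem_of_inChain hX hs hs2 (by omega) (by omega) hc)
  have h1 := h.eq_of_not_inChain hX hc' hnc (i := I s) (by omega) rfl
  have h2 := h.lt_index_succ hs.le (by omega)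
  omega

end Swap

end SpecialSymbol

theorem card_range_filter_even (n : ℕ) :
    ((Finset.range n).filter fun s => s % 2 = 0).card = (n + 1) / 2 := by
  induction n with
  | zero => rfl
  | succ n ih =>
    rw [Finset.range_add_one, Finset.filter_insert]
    split_ifs with h
    · rw [Finset.card_insert_of_notMem (by simp), ih]
      omega
    · rw [ih]
      omega

/-- Setup §2: the map `X ↦ a^X` on subsets
`X ⊆ {0,2,4,…} ∩ [0,μ-1]` is injective, and
`{b ∈ ℰ : [b°] = [a°]} = {a^X : X ⊆ {0,2,4,…} ∩ [0,μ-1]}`; consequently the set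
`{b ∈ ℰ : [b°] = [a°]}` (viewed as a set of tuples of length `N+1`) has exactly
`2^⌈μ/2⌉` elements. -/
theorem stmt_14 (N μ : ℕ) (a I m : ℕ → ℕ)
    (hμ : μ % 2 = N % 2)
    (hmono : ∀ i, i + 1 ≤ N → a i ≤ a (i + 1))
    (hstrict : ∀ i, i + 2 ≤ N → a i < a (i + 2))
    (hImono : ∀ s t, s < t → t ≤ μ → I s < I t)
    (hIJ : ∀ i, (i ≤ N ∧ ((Finset.range (N + 1)).filter fun j => a j = a i).card = 1)
        ↔ ∃ s, s ≤ μ ∧ I s = i)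
    (hm : ∀ s, s < μ → I (s + 1) = I s + 2 * m s + 1)
    -- `S = {0,2,4,…} ∩ [0,μ-1]`:
    (S : Finset ℕ) (hS : S = (Finset.range μ).filter fun s => s % 2 = 0)
    -- `aX X` is the sequence `a^X`, for each `X ⊆ S`:
    (aX : Finset ℕ → ℕ → ℕ)
    (haX : ∀ X ⊆ S, ∀ s ∈ X, ∀ k ≤ m s,
        aX X (I s + 2 * k) = a (I s + 2 * k + 1)
        ∧ aX X (I s + 2 * k + 1) = a (I s + 2 * k))
    (haX' : ∀ X ⊆ S, ∀ i ≤ N,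
        (∀ s ∈ X, ¬ (I s ≤ i ∧ i ≤ I s + 2 * m s + 1)) → aX X i = a i) :
    -- injectivity of `X ↦ a^X`:
    (∀ X ⊆ S, ∀ Y ⊆ S, (∀ i ≤ N, aX X i = aX Y i) → X = Y)
    -- `{b ∈ ℰ : [b°] = [a°]} = {a^X : X ⊆ S}`:
    ∧ (∀ b : ℕ → ℕ,
        ((∀ i, i + 2 ≤ N → b i < b (i + 2))
          ∧ (Multiset.range (N + 1)).map b = (Multiset.range (N + 1)).map a
          ∧ (Multiset.range (N + 1)).map (fun i => b i + i / 2)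
              = (Multiset.range (N + 1)).map (fun i => a i + i / 2))
        ↔ ∃ X ⊆ S, ∀ i ≤ N, b i = aX X i)
    -- the cardinality of `{b ∈ ℰ : [b°] = [a°]}` is `2^⌈μ/2⌉`:
    ∧ Set.ncard {p : Fin (N + 1) → ℕ |
        (∀ i : ℕ, ∀ h : i + 2 ≤ N, p ⟨i, by omega⟩ < p ⟨i + 2, by omega⟩)
        ∧ Finset.univ.val.map p = Finset.univ.val.map (fun i : Fin (N + 1) => a i)
        ∧ Finset.univ.val.map (fun i : Fin (N + 1) => p i + (i : ℕ) / 2)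
            = Finset.univ.val.map (fun i : Fin (N + 1) => a i + (i : ℕ) / 2)}
      = 2 ^ ((μ + 1) / 2) := by
  have h : SpecialSymbol N μ a I m := ⟨hμ, hmono, hstrict, hImono, hIJ, hm⟩
  subst hS
  have hinj : ∀ X ⊆ (Finset.range μ).filter fun s => s % 2 = 0,
      ∀ Y ⊆ (Finset.range μ).filter fun s => s % 2 = 0,
      (∀ i ≤ N, aX X i = aX Y i) → X = Y := by
    intro X hX Y hY hXY
    have hmem : ∀ s < μ, s % 2 = 0 → (s ∈ X ↔ s ∈ Y) := by
      intro s hs hs2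
      rw [h.mem_iff_swap hX (haX X hX) (haX' X hX) hs hs2,
        h.mem_iff_swap hY (haX Y hY) (haX' Y hY) hs hs2, hXY _ (h.index_le hs.le)]
    ext s
    constructor
    · intro hs
      have h1 := hX hs
      simp only [Finset.mem_filter, Finset.mem_range] at h1
      exact (hmem s h1.1 h1.2).1 hs
    · intro hs
      have h1 := hY hs
      simp only [Finset.mem_filter, Finset.mem_range] at h1
      exact (hmem s h1.1 h1.2).2 hs
  have hchar : ∀ b : ℕ → ℕ,
      ((∀ i, i + 2 ≤ N → b i < b (i + 2))
        ∧ (Multiset.range (N + 1)).map b = (Multiset.range (N + 1)).map a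
        ∧ (Multiset.range (N + 1)).map (fun i => b i + i / 2)
            = (Multiset.range (N + 1)).map (fun i => a i + i / 2))
      ↔ ∃ X ⊆ (Finset.range μ).filter fun s => s % 2 = 0, ∀ i ≤ N, b i = aX X i := by
    intro b
    constructor
    · rintro ⟨hb, h1, h2⟩
      have hB := blockEq_of_map_eq_of_blockMono h.le_of_lt
        (blockMono_of_map_add_half_eq h.le_of_lt h1 h2) h1
      have hX : (((Finset.range μ).filter fun s => s % 2 = 0).filter
          fun s => b (I s) = a (I s + 1)) ⊆ (Finset.range μ).filter fun s => s % 2 = 0 :=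
        Finset.filter_subset _ _
      refine ⟨_, hX, fun i hi => h.eq_swap hX (haX _ hX) (haX' _ hX) hb hB ?_ hi⟩
      intro s hs hs2
      simp only [Finset.mem_filter, Finset.mem_range, hs, hs2, true_and]
    · rintro ⟨X, hX, hbX⟩
      have hB : BlockEq (N + 1) b a := by
        intro k
        have hk := h.blockEq_swap hX (haX X hX) (haX' X hX) k
        refine ⟨fun hN => ?_, fun hN => ?_⟩
        · rw [hbX _ (by omega), hbX _ (by omega)]
          exact hk.1 hN
        · rw [hbX _ (by omega)]
          exact hk.2 hN
      refine ⟨fun i hi => ?_, hB.map_range_eq, hB.add_half.map_range_eq⟩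
      rw [hbX _ (by omega), hbX _ hi]
      exact h.strict_swap hX (haX X hX) (haX' X hX) hi
  refine ⟨hinj, hchar, ?_⟩
  have himage : {p : Fin (N + 1) → ℕ |
        (∀ i : ℕ, ∀ h : i + 2 ≤ N, p ⟨i, by omega⟩ < p ⟨i + 2, by omega⟩)
        ∧ Finset.univ.val.map p = Finset.univ.val.map (fun i : Fin (N + 1) => a i)
        ∧ Finset.univ.val.map (fun i : Fin (N + 1) => p i + (i : ℕ) / 2)
            = Finset.univ.val.map (fun i : Fin (N + 1) => a i + (i : ℕ) / 2)}
      = (fun (X : Finset ℕ) (i : Fin (N + 1)) => aX X i) ''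
        (((Finset.range μ).filter fun s => s % 2 = 0).powerset : Set (Finset ℕ)) := by
    ext p
    obtain ⟨b, rfl⟩ : ∃ b : ℕ → ℕ, p = fun i : Fin (N + 1) => b i :=
      ⟨fun i => if hi : i < N + 1 then p ⟨i, hi⟩ else 0, by
        ext i
        simp only [i.2, dite_true]⟩
    have hb := hchar b
    rw [← map_univ_fin_val, ← map_univ_fin_val, ← map_univ_fin_val (N + 1) fun i => b i + i / 2,
      ← map_univ_fin_val (N + 1) fun i => a i + i / 2] at hb
    simp only [Set.mem_ofPred_eq, Set.mem_image, Finset.mem_coe, Finset.mem_powerset]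
    refine hb.trans (exists_congr fun X => and_congr_right fun _ => ?_)
    rw [funext_iff]
    exact ⟨fun hX i => (hX i (by omega)).symm, fun hX i hi => (hX ⟨i, by omega⟩).symm⟩
  rw [himage, Set.InjOn.ncard_image, Set.ncard_coe_finset, Finset.card_powerset,
    card_range_filter_even]
  intro X hX Y hY hXY
  exact hinj X (Finset.mem_powerset.1 hX) Y (Finset.mem_powerset.1 hY)
    fun i hi => congrFun hXY ⟨i, by omega⟩
end
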